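/- arXiv:1804.06220 — 5 statements merged into one kernel-verified Lean document; each statement's English description precedes it below -/
import Mathlib

section
/- Let n, d ≥ 1 be integers and let s : ℤ → ℝ be an even function with s(0) = 1. On a probability space, let (X_{ij})_{1≤i≤n, 1≤j≤d} be jointly Gaussian centered random variables with E[X_{ij} X_{i'j'}] = 1_{{i=i'}} · s(j − j'). Define the normalized Wishart matrix W = (W_{ij})_{1≤i,j≤n} by W_{ij} = d^{-1/2} ( Σ_{k=1}^d X_{ik} X_{jk} − d·1_{{i=j}} ). Let G = (G_{ij})_{1≤i,j≤n} be a symmetric random matrix whose entries are jointly Gaussian and centered with E[G_{ij} G_{uv}] = (1_{{i=u}}1_{{j=v}} + 1_{{i=v}}1_{{j=u}}) · σ_d², where σ_d² = d^{-1} Σ_{k,l=1}^d s(k−l)² (this is exactly the covariance structure of W). Then for every function g : M_n(ℝ) → ℝ that is 1-Lipschitz with respect to the Frobenius (Hilbert–Schmidt) norm, E[g(W)] − E[g(G)] ≤ √( 192 n³ (Σ_{|k|≤d} |s(k)|^{4/3})³ / ( d · Σ_{|k|≤d} (1 − |k|/d) s(k)² ) ). -/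
open MeasureTheory ProbabilityTheory

/-- A family of real random variables is jointly Gaussian and centered if every finite
linear combination of its members has a centered Gaussian law. -/
def IsCenteredGaussianFamily {Ω : Type*} [MeasureSpace Ω] {ι : Type*} (X : ι → Ω → ℝ) : Prop :=
  ∀ (S : Finset ι) (c : ι → ℝ), ∃ v : NNReal,
    Measure.map (fun ω => ∑ i ∈ S, c i * X i ω) volume = gaussianReal 0 v

/-- Stein's identity for a centered real Gaussian law. -/
theorem integral_id_mul_gaussianReal {v : NNReal} {f f' : ℝ → ℝ}
    (hf : ∀ x, HasDerivAt f (f' x) x)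
    (hfi : Integrable f (gaussianReal 0 v)) (hf'i : Integrable f' (gaussianReal 0 v))
    (hxf : Integrable (fun x => x * f x) (gaussianReal 0 v)) :
    ∫ x, x * f x ∂gaussianReal 0 v = v * ∫ x, f' x ∂gaussianReal 0 v := by
  rcases eq_or_ne v 0 with rfl | hv
  · simp [gaussianReal_zero_var]
  have hv' : (v : ℝ) ≠ 0 := by exact_mod_cast hv
  have hint : ∀ h : ℝ → ℝ, Integrable h (gaussianReal 0 v) →
      Integrable (fun x => gaussianPDFReal 0 v x * h x) := fun h hh => by
    rw [gaussianReal_of_var_ne_zero _ hv,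
      integrable_withDensity_iff_integrable_smul' (measurable_gaussianPDF _ _)
      (ae_of_all _ fun _ => gaussianPDF_lt_top)] at hh
    simpa using hh
  have hp : ∀ x, HasDerivAt (gaussianPDFReal 0 v) (-(x / v) * gaussianPDFReal 0 v x) x := fun x => by
    have h1 : HasDerivAt (fun y : ℝ => -(y - 0) ^ 2 / (2 * v)) (-(x / v)) x := by
      have := ((((hasDerivAt_id x).sub_const 0).pow 2).neg).div_const (2 * (v : ℝ))
      refine this.congr_deriv ?_
      simp only [id, sub_zero, Nat.cast_ofNat]
      field_simp
      norm_num
    have := (h1.exp).const_mul ((Real.sqrt (2 * Real.pi * v))⁻¹)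
    rw [gaussianPDFReal_def]
    exact this.congr_deriv (by ring)
  rw [integral_gaussianReal_eq_integral_smul hv, integral_gaussianReal_eq_integral_smul hv]
  have key := integral_mul_deriv_eq_deriv_mul_of_integrable (u := gaussianPDFReal 0 v) (v := f)
    (fun x _ => hp x) (fun x _ => hf x) (hint _ hf'i)
    (by
      have := (hint _ hxf).const_mul (-(1 / v : ℝ))
      refine this.congr (ae_of_all _ fun x => ?_)
      simp only [Pi.mul_apply]; ring)
    (hint _ hfi)
  simp only [smul_eq_mul]
  rw [key, ← integral_neg, ← integral_const_mul]
  refine integral_congr_ae (ae_of_all _ fun x => ?_)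
  field_simp

section IntegrationByParts

variable {Ω : Type*} [MeasurableSpace Ω] {μ : Measure Ω}

/-- Gaussian integration by parts: if `C` is the covariance of `N a` with the vector `N`, then
`E[N a * φ N] = E[∂_C φ N]`. -/
theorem integral_mul_eq_integral_lineDeriv {ι : Type*} [Fintype ι] {N : ι → Ω → ℝ}
    (hN : HasGaussianLaw (fun ω i => N i ω) μ) (h0 : ∀ i, ∫ ω, N i ω ∂μ = 0) (a : ι) {C : ι → ℝ}
    (hC : ∀ b, ∫ ω, N a ω * N b ω ∂μ = C b) {φ φ' : (ι → ℝ) → ℝ}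
    (hφ : ∀ x, HasLineDerivAt ℝ φ (φ' x) x C) (hφm : Measurable φ) (hφ'm : Measurable φ')
    (hφi : Integrable (fun ω => φ (fun i => N i ω)) μ)
    (hφ'i : Integrable (fun ω => φ' (fun i => N i ω)) μ)
    (hNφ : Integrable (fun ω => N a ω * φ (fun i => N i ω)) μ) :
    ∫ ω, N a ω * φ (fun i => N i ω) ∂μ = ∫ ω, φ' (fun i => N i ω) ∂μ := by
  have hprob := hN.isProbabilityMeasure
  have hL2 : ∀ i, MemLp (N i) 2 μ := fun i => (hN.eval i).memLp_two
  have hcov : ∀ b, cov[N a, N b; μ] = C b := fun b => by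
    rw [covariance_eq_sub (hL2 a) (hL2 b), h0, h0, ← hC]; simp
  rcases eq_or_ne (C a) 0 with hCa | hCa
  · have hz : N a =ᵐ[μ] 0 := by
      have h1 : ∫ ω, N a ω ^ 2 ∂μ = 0 := by rw [← hCa, ← hC]; simp [sq]
      rw [integral_eq_zero_iff_of_nonneg (fun _ => sq_nonneg _) (hL2 a).integrable_sq] at h1
      filter_upwards [h1] with ω hω
      simpa using hω
    have hC0 : C = 0 := funext fun b => by
      rw [← hC]
      simpa using integral_congr_ae (g := fun _ => (0 : ℝ)) (hz.mono fun ω hω => by simp [hω])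
    have hφ'0 : ∀ x, φ' x = 0 := fun x => (hφ x).unique (hC0 ▸ hasLineDerivAt_zero)
    simp only [hφ'0, integral_zero]
    simpa using integral_congr_ae (g := fun _ => (0 : ℝ)) (hz.mono fun ω hω => by simp [hω])
  have hvar : Var[N a; μ] = C a := by rw [← hcov, covariance_self (hN.eval a).aemeasurable]
  have hCpos : 0 < C a := lt_of_le_of_ne (hvar ▸ variance_nonneg _ _) hCa.symm
  have hmap : μ.map (N a) = gaussianReal 0 (C a).toNNReal := by
    rw [(hN.eval a).map_eq_gaussianReal, h0, hvar]
  set R : ι → Ω → ℝ := fun b ω => N b ω - C b / C a * N a ω with hR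
  have hjoint : HasGaussianLaw (fun ω => (fun _ : Unit => N a ω, fun b => R b ω)) μ := by
    let P : (ι → ℝ) →L[ℝ] (Unit → ℝ) × (ι → ℝ) :=
      (ContinuousLinearMap.pi fun _ => ContinuousLinearMap.proj a).prod
        (ContinuousLinearMap.pi fun b =>
          ContinuousLinearMap.proj b - (C b / C a) • ContinuousLinearMap.proj a)
    exact hN.map_fun P
  have hind : IndepFun (N a) (fun ω b => R b ω) μ := by
    have := hjoint.indepFun_of_covariance_eval (X := fun _ : Unit => N a) (Y := R) fun _ b => by
      have : R b = N b - fun ω => C b / C a * N a ω := rfl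
      rw [this, covariance_sub_right (hL2 a) (hL2 b) ((hL2 a).const_mul _),
        covariance_const_mul_right, hcov, hcov]
      field_simp
      ring
    have heval : Measurable fun x : Unit → ℝ => x () := measurable_pi_apply ()
    exact this.comp heval measurable_id
  have hmN : AEMeasurable (N a) μ := (hN.eval a).aemeasurable
  have hmR : AEMeasurable (fun ω b => R b ω) μ := hjoint.snd.aemeasurable
  have hlaw := (indepFun_iff_map_prod_eq_prod_map_map hmN hmR).1 hind
  rw [hmap] at hlaw
  set γ := gaussianReal 0 (C a).toNNReal with hγ
  set ρ := μ.map (fun ω b => R b ω)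
  have : IsProbabilityMeasure ρ := Measure.isProbabilityMeasure_map hmR
  let T : ℝ × (ι → ℝ) → ι → ℝ := fun p => p.2 + (p.1 / C a) • C
  have hTm : Measurable T := by fun_prop
  have hTN : ∀ ω, T (N a ω, fun b => R b ω) = fun i => N i ω := fun ω => by
    ext b
    simp only [T, hR, Pi.add_apply, Pi.smul_apply, smul_eq_mul]
    ring
  have transfer : ∀ F : ℝ × (ι → ℝ) → ℝ, Measurable F →
      (Integrable (fun ω => F (N a ω, fun b => R b ω)) μ ↔ Integrable F (γ.prod ρ)) ∧
      ∫ ω, F (N a ω, fun b => R b ω) ∂μ = ∫ p, F p ∂(γ.prod ρ) := fun F hF => by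
    rw [← hlaw]
    exact ⟨(integrable_map_measure hF.aestronglyMeasurable (hmN.prodMk hmR)).symm,
      (integral_map (hmN.prodMk hmR) hF.aestronglyMeasurable).symm⟩
  have t1 := transfer (fun p => φ (T p)) (hφm.comp hTm)
  have t2 := transfer (fun p => φ' (T p)) (hφ'm.comp hTm)
  have t3 := transfer (fun p => p.1 * φ (T p)) (measurable_fst.mul (hφm.comp hTm))
  simp only [hTN] at t1 t2 t3
  rw [t2.2, t3.2, integral_prod_symm _ (t3.1.1 hNφ), integral_prod_symm _ (t2.1.1 hφ'i)]
  refine integral_congr_ae ?_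
  filter_upwards [(t1.1.1 hφi).prod_left_ae, (t2.1.1 hφ'i).prod_left_ae,
    (t3.1.1 hNφ).prod_left_ae] with r h1 h2 h3
  have hd : ∀ x, HasDerivAt (fun x => φ (T (x, r))) ((C a)⁻¹ * φ' (T (x, r))) x := fun x => by
    have h := hφ (T (x, r))
    rw [HasLineDerivAt] at h
    have hs : HasDerivAt (fun y => (y - x) / C a) ((C a)⁻¹) x := by
      simpa using ((hasDerivAt_id x).sub_const x).div_const (C a)
    have h' : HasDerivAt (fun t => φ (T (x, r) + t • C)) (φ' (T (x, r))) ((x - x) / C a) := by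
      simpa using h
    have := h'.comp x hs
    rw [mul_comm]
    refine this.congr_of_eventuallyEq (Filter.Eventually.of_forall fun y => ?_)
    simp only [T, Function.comp, add_assoc, ← add_smul]
    congr 3
    ring
  have hst := integral_id_mul_gaussianReal hd h1 (h2.const_mul _) h3
  rw [hst, integral_const_mul, Real.coe_toNNReal _ hCpos.le, ← hγ]
  field_simp

end IntegrationByParts

section Smoothing

variable {κ : Type*} [Fintype κ]

theorem sqrt_sum_sq_sub_le (x y : κ → ℝ) :
    Real.sqrt (∑ i, (x i - y i) ^ 2) ≤ Real.sqrt (Fintype.card κ) * ‖x - y‖ := by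
  rw [Real.sqrt_le_left (by positivity), mul_pow, Real.sq_sqrt (by positivity)]
  calc ∑ i, (x i - y i) ^ 2 ≤ ∑ _i : κ, ‖x - y‖ ^ 2 := Finset.sum_le_sum fun i _ => by
        rw [← sq_abs]
        exact pow_le_pow_left₀ (abs_nonneg _) (norm_le_pi_norm (x - y) i) 2
    _ = _ := by simp

theorem lipschitzWith_of_abs_sub_le_euclidean {g : (κ → ℝ) → ℝ}
    (hg : ∀ x y, |g x - g y| ≤ Real.sqrt (∑ i, (x i - y i) ^ 2)) :
    LipschitzWith (NNReal.sqrt (Fintype.card κ)) g :=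
  LipschitzWith.of_dist_le_mul fun x y => by
    rw [Real.dist_eq, dist_eq_norm]
    simpa using (hg x y).trans (sqrt_sum_sq_sub_le x y)

/-- The gradient of a function that is 1-Lipschitz for the Euclidean norm has norm at most one. -/
theorem sum_sq_fderiv_single_le_one [DecidableEq κ] {f : (κ → ℝ) → ℝ} (hd : Differentiable ℝ f)
    (hf : ∀ x y, |f x - f y| ≤ Real.sqrt (∑ i, (x i - y i) ^ 2)) (x : κ → ℝ) :
    ∑ i, (fderiv ℝ f x (Pi.single i 1)) ^ 2 ≤ 1 := by
  set v : κ → ℝ := fun i => fderiv ℝ f x (Pi.single i 1) with hv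
  have hS : 0 ≤ ∑ i, v i ^ 2 := by positivity
  have hDv : fderiv ℝ f x v = ∑ i, v i ^ 2 := by
    conv_lhs => rw [pi_eq_sum_univ' v]
    simp only [map_sum, map_smul, smul_eq_mul, sq]
    refine Finset.sum_congr rfl fun i _ => ?_
    congr 1
  have hline : HasDerivAt (fun t : ℝ => f (x + t • v)) (fderiv ℝ f x v) 0 :=
    (hd x).hasFDerivAt.hasLineDerivAt v
  have hlip : LipschitzWith (NNReal.sqrt (Real.toNNReal (∑ i, v i ^ 2)))
      (fun t : ℝ => f (x + t • v)) := LipschitzWith.of_dist_le_mul fun s t => by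
    rw [Real.dist_eq, Real.dist_eq, Real.coe_sqrt, Real.coe_toNNReal _ hS]
    refine (hf _ _).trans (le_of_eq ?_)
    rw [← Real.sqrt_sq_eq_abs, ← Real.sqrt_mul hS, Finset.sum_mul]
    congr 1
    refine Finset.sum_congr rfl fun i _ => ?_
    simp only [Pi.add_apply, Pi.smul_apply, smul_eq_mul]
    ring
  have hle := hline.le_of_lipschitz hlip
  rw [hDv, Real.coe_sqrt, Real.coe_toNNReal _ hS, Real.norm_of_nonneg hS] at hle
  have h2 := pow_le_pow_left₀ hS hle 2
  rw [Real.sq_sqrt hS] at h2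
  nlinarith

theorem norm_convolution_sub_le {E F : Type*} [NormedAddCommGroup E] [NormedSpace ℝ E]
    [NormedAddCommGroup F] [NormedSpace ℝ F]
    (L : E →L[ℝ] ℝ →L[ℝ] F) {ψ : (κ → ℝ) → E} (hψ : Continuous ψ) (hψc : HasCompactSupport ψ)
    {g : (κ → ℝ) → ℝ} (hg : Continuous g) {x y : κ → ℝ} {δ : ℝ}
    (hδ : ∀ t, |g (x - t) - g (y - t)| ≤ δ) :
    ‖convolution ψ g L volume x - convolution ψ g L volume y‖ ≤ (‖L‖ * ∫ t, ‖ψ t‖) * δ := by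
  have hex : ConvolutionExists ψ g L volume :=
    hψc.convolutionExists_left L hψ hg.locallyIntegrable
  rw [convolution_def, convolution_def, ← integral_sub (hex x) (hex y), ← integral_const_mul,
    ← integral_mul_const]
  refine norm_integral_le_of_norm_le
    (((hψ.integrable_of_hasCompactSupport hψc).norm.const_mul _).mul_const _)
    (ae_of_all _ fun t => ?_)
  rw [← map_sub]
  refine (L.le_opNorm₂ _ _).trans ?_
  exact mul_le_mul_of_nonneg_left (hδ t) (by positivity)

theorem exists_lipschitzWith_convolution {E F : Type*} [NormedAddCommGroup E] [NormedSpace ℝ E]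
    [NormedAddCommGroup F] [NormedSpace ℝ F]
    (L : E →L[ℝ] ℝ →L[ℝ] F) {ψ : (κ → ℝ) → E} (hψ : Continuous ψ) (hψc : HasCompactSupport ψ)
    {g : (κ → ℝ) → ℝ} {K : NNReal} (hg : LipschitzWith K g) :
    ∃ M, LipschitzWith M (convolution ψ g L volume) := by
  have hI : 0 ≤ ∫ t, ‖ψ t‖ := integral_nonneg fun _ => norm_nonneg _
  refine ⟨(‖L‖ * (∫ t, ‖ψ t‖) * K).toNNReal, LipschitzWith.of_dist_le_mul fun x y => ?_⟩
  rw [dist_eq_norm, Real.coe_toNNReal _ (by positivity), mul_assoc _ (K : ℝ)]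
  refine norm_convolution_sub_le L hψ hψc hg.continuous fun t => ?_
  simpa [Real.dist_eq] using hg.dist_le_mul (x - t) (y - t)

/-- Functions that are 1-Lipschitz for the Euclidean norm are uniform limits of such functions
that are moreover twice continuously differentiable with bounded second derivative. -/
theorem exists_contDiff_approx {g : (κ → ℝ) → ℝ}
    (hg : ∀ x y, |g x - g y| ≤ Real.sqrt (∑ i, (x i - y i) ^ 2)) {ε : ℝ} (hε : 0 < ε) :
    ∃ f : (κ → ℝ) → ℝ, ContDiff ℝ 2 f ∧
      (∀ x y, |f x - f y| ≤ Real.sqrt (∑ i, (x i - y i) ^ 2)) ∧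
      (∀ x, |f x - g x| ≤ ε) ∧ ∃ L, ∀ x, ‖fderiv ℝ (fderiv ℝ f) x‖ ≤ L := by
  have hgl := lipschitzWith_of_abs_sub_le_euclidean hg
  have hgc := hgl.continuous
  set K := Real.sqrt (Fintype.card κ) with hK
  have hr : 0 < ε / (K + 1) := by positivity
  let φ : ContDiffBump (0 : κ → ℝ) := ⟨ε / (K + 1) / 2, ε / (K + 1), by positivity, by linarith⟩
  have hφs : ContDiff ℝ 2 (φ.normed volume) := φ.contDiff_normed (n := 2)
  have hφc : HasCompactSupport (φ.normed volume) := φ.hasCompactSupport_normed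
  have hφ1 : ContDiff ℝ 1 (φ.normed volume) := hφs.of_le (by norm_num)
  refine ⟨convolution (φ.normed volume) g (ContinuousLinearMap.lsmul ℝ ℝ) volume,
    hφc.contDiff_convolution_left (n := 2) _ hφs hgc.locallyIntegrable, fun x y => ?_, fun x => ?_,
    ?_⟩
  · have h := norm_convolution_sub_le (ContinuousLinearMap.lsmul ℝ ℝ) φ.continuous_normed hφc hgc
      (x := x) (y := y) (δ := Real.sqrt (∑ i, (x i - y i) ^ 2)) fun t => by simpa using hg (x - t) (y - t)
    refine h.trans ?_
    have h1 : ∫ t, ‖φ.normed volume t‖ = 1 := by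
      simp_rw [Real.norm_of_nonneg (φ.nonneg_normed _)]
      exact φ.integral_normed
    rw [h1, mul_one]
    refine mul_le_of_le_one_left (Real.sqrt_nonneg _) ?_
    exact ContinuousLinearMap.opNorm_lsmul_le
  · refine φ.dist_normed_convolution_le hgc.aestronglyMeasurable fun y hy => ?_
    rw [Real.dist_eq]
    refine ((hg y x).trans (sqrt_sum_sq_sub_le y x)).trans ?_
    rw [Metric.mem_ball, dist_eq_norm] at hy
    calc K * ‖y - x‖ ≤ (K + 1) * (ε / (K + 1)) := by
          gcongr
          linarith
      _ = ε := mul_div_cancel₀ _ (by positivity)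
  · have hder : fderiv ℝ (convolution (φ.normed volume) g (ContinuousLinearMap.lsmul ℝ ℝ) volume) =
        convolution (fderiv ℝ (φ.normed volume)) g
          ((ContinuousLinearMap.lsmul ℝ ℝ).precompL (κ → ℝ)) volume := funext fun x =>
      (hφc.hasFDerivAt_convolution_left (ContinuousLinearMap.lsmul ℝ ℝ) hφ1
        hgc.locallyIntegrable x).fderiv
    rw [hder]
    obtain ⟨M, hM⟩ := exists_lipschitzWith_convolution
      ((ContinuousLinearMap.lsmul ℝ ℝ).precompL (κ → ℝ))
      (hφ1.continuous_fderiv (by norm_num)) (hφc.fderiv ℝ) hgl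
    exact ⟨M, fun x => norm_fderiv_le_of_lipschitz ℝ hM⟩

end Smoothing

section Combinatorics

theorem mul_mul_mul_le_of_rpow {a b c e : ℝ} (ha : 0 ≤ a) (hb : 0 ≤ b) (hc : 0 ≤ c) (he : 0 ≤ e) :
    a * b * c * e ≤ 1 / 4 *
      (a ^ (4 / 3 : ℝ) * b ^ (4 / 3 : ℝ) * c ^ (4 / 3 : ℝ)
        + b ^ (4 / 3 : ℝ) * c ^ (4 / 3 : ℝ) * e ^ (4 / 3 : ℝ)
        + c ^ (4 / 3 : ℝ) * e ^ (4 / 3 : ℝ) * a ^ (4 / 3 : ℝ)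
        + e ^ (4 / 3 : ℝ) * a ^ (4 / 3 : ℝ) * b ^ (4 / 3 : ℝ)) := by
  have h := Real.geom_mean_le_arith_mean4_weighted (w₁ := 1 / 4) (w₂ := 1 / 4) (w₃ := 1 / 4)
    (w₄ := 1 / 4) (p₁ := a ^ (4 / 3 : ℝ) * b ^ (4 / 3 : ℝ) * c ^ (4 / 3 : ℝ))
    (p₂ := b ^ (4 / 3 : ℝ) * c ^ (4 / 3 : ℝ) * e ^ (4 / 3 : ℝ))
    (p₃ := c ^ (4 / 3 : ℝ) * e ^ (4 / 3 : ℝ) * a ^ (4 / 3 : ℝ))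
    (p₄ := e ^ (4 / 3 : ℝ) * a ^ (4 / 3 : ℝ) * b ^ (4 / 3 : ℝ))
    (by norm_num) (by norm_num) (by norm_num) (by norm_num)
    (by positivity) (by positivity) (by positivity) (by positivity) (by norm_num)
  have hpow : ∀ {x : ℝ}, 0 ≤ x → (x ^ (4 / 3 : ℝ)) ^ (1 / 4 : ℝ) = x ^ (1 / 3 : ℝ) := fun hx => by
    rw [← Real.rpow_mul hx]; norm_num
  have hcube : ∀ {x : ℝ}, 0 ≤ x → x = x ^ (1 / 3 : ℝ) * x ^ (1 / 3 : ℝ) * x ^ (1 / 3 : ℝ) :=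
    fun {x} hx => by
      rw [← Real.rpow_add_of_nonneg hx (by norm_num) (by norm_num),
        ← Real.rpow_add_of_nonneg hx (by norm_num) (by norm_num)]
      norm_num
  have hprod : ∀ {x y z : ℝ}, 0 ≤ x → 0 ≤ y → 0 ≤ z →
      (x ^ (4 / 3 : ℝ) * y ^ (4 / 3 : ℝ) * z ^ (4 / 3 : ℝ)) ^ (1 / 4 : ℝ) =
        x ^ (1 / 3 : ℝ) * y ^ (1 / 3 : ℝ) * z ^ (1 / 3 : ℝ) := fun hx hy hz => by
    rw [Real.mul_rpow (by positivity) (by positivity), Real.mul_rpow (by positivity) (by positivity),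
      hpow hx, hpow hy, hpow hz]
  rw [hprod ha hb hc, hprod hb hc he, hprod hc he ha, hprod he ha hb] at h
  calc a * b * c * e = _ := by
        conv_lhs => rw [hcube ha, hcube hb, hcube hc, hcube he]
        ring
    _ ≤ _ := h
    _ = _ := by ring

theorem sum_rotate {ι : Type*} [Fintype ι] (F : ι → ι → ι → ι → ℝ) :
    ∑ k, ∑ l, ∑ m, ∑ o, F l m o k = ∑ k, ∑ l, ∑ m, ∑ o, F k l m o := by
  rw [Finset.sum_comm]
  refine Finset.sum_congr rfl fun l _ => ?_
  rw [Finset.sum_comm]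
  exact Finset.sum_congr rfl fun m _ => Finset.sum_comm

theorem sum_sub_le_sum_Icc {d : ℕ} {b : ℤ → ℝ} (hb : ∀ k, 0 ≤ b k) (k : Fin d) :
    ∑ l : Fin d, b ((k : ℤ) - (l : ℤ)) ≤ ∑ m ∈ Finset.Icc (-(d : ℤ)) d, b m := by
  rw [← Finset.sum_image (s := Finset.univ) (g := fun l : Fin d => (k : ℤ) - (l : ℤ)) (f := b)
    (fun x _ y _ h => Fin.ext (by simp only at h; omega))]
  refine Finset.sum_le_sum_of_subset_of_nonneg (fun m hm => ?_) fun m _ _ => hb m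
  obtain ⟨l, -, rfl⟩ := Finset.mem_image.1 hm
  rw [Finset.mem_Icc]
  omega

theorem sum_path_le {d : ℕ} {b : ℤ → ℝ} (hb : ∀ k, 0 ≤ b k) :
    ∑ k : Fin d, ∑ l : Fin d, ∑ m : Fin d, ∑ o : Fin d,
      b ((k : ℤ) - l) * b ((l : ℤ) - m) * b ((m : ℤ) - o) ≤
      d * (∑ m ∈ Finset.Icc (-(d : ℤ)) d, b m) ^ 3 := by
  set B := ∑ m ∈ Finset.Icc (-(d : ℤ)) d, b m with hB
  have hB0 : 0 ≤ B := Finset.sum_nonneg fun m _ => hb m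
  have hrow := fun k : Fin d => sum_sub_le_sum_Icc hb k
  calc _ ≤ ∑ k : Fin d, ∑ l : Fin d, ∑ m : Fin d, b ((k : ℤ) - l) * b ((l : ℤ) - m) * B := by
        simp_rw [← Finset.mul_sum]
        gcongr with k _ l _ m _
        · exact mul_nonneg (hb _) (hb _)
        · exact hrow m
    _ ≤ ∑ k : Fin d, ∑ l : Fin d, b ((k : ℤ) - l) * B * B := by
        refine Finset.sum_le_sum fun k _ => Finset.sum_le_sum fun l _ => ?_
        rw [← Finset.sum_mul, ← Finset.mul_sum]
        exact mul_le_mul_of_nonneg_right (mul_le_mul_of_nonneg_left (hrow l) (hb _)) hB0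
    _ ≤ ∑ k : Fin d, B * B * B := by
        simp_rw [← Finset.sum_mul]
        gcongr with k _
        exact hrow k
    _ = _ := by rw [Finset.sum_const, Finset.card_univ, Fintype.card_fin, nsmul_eq_mul]; ring

/-- Young's inequality for closed walks of length four. -/
theorem sum_cycle_le {d : ℕ} (s : ℤ → ℝ) :
    ∑ k : Fin d, ∑ l : Fin d, ∑ m : Fin d, ∑ o : Fin d,
      s ((k : ℤ) - l) * s ((l : ℤ) - m) * s ((m : ℤ) - o) * s ((o : ℤ) - k) ≤
      d * (∑ m ∈ Finset.Icc (-(d : ℤ)) d, |s m| ^ (4 / 3 : ℝ)) ^ 3 := by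
  obtain ⟨b, hbs⟩ : ∃ b : ℤ → ℝ, ∀ k, |s k| ^ (4 / 3 : ℝ) = b k := ⟨_, fun _ => rfl⟩
  have hb : ∀ k, 0 ≤ b k := fun k => hbs k ▸ Real.rpow_nonneg (abs_nonneg _) _
  simp only [hbs]
  obtain ⟨F, hF⟩ : ∃ F : Fin d → Fin d → Fin d → Fin d → ℝ, ∀ k l m o, F k l m o =
    b ((k : ℤ) - l) * b ((l : ℤ) - m) * b ((m : ℤ) - o) := ⟨_, fun _ _ _ _ => rfl⟩
  have hpath : ∑ k, ∑ l, ∑ m, ∑ o, F k l m o ≤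
      d * (∑ m ∈ Finset.Icc (-(d : ℤ)) d, b m) ^ 3 := by
    simp only [hF]
    exact sum_path_le hb
  have hpoint : ∀ k l m o : Fin d,
      s ((k : ℤ) - l) * s ((l : ℤ) - m) * s ((m : ℤ) - o) * s ((o : ℤ) - k) ≤
        1 / 4 * (F k l m o + F l m o k + F m o k l + F o k l m) := fun k l m o => by
    refine (le_abs_self _).trans ?_
    have h := mul_mul_mul_le_of_rpow (abs_nonneg (s ((k : ℤ) - l))) (abs_nonneg (s ((l : ℤ) - m)))
      (abs_nonneg (s ((m : ℤ) - o))) (abs_nonneg (s ((o : ℤ) - k)))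
    rw [hbs, hbs, hbs, hbs] at h
    rwa [abs_mul, abs_mul, abs_mul, hF, hF, hF, hF]
  have r1 := sum_rotate F
  have r2 : ∑ k, ∑ l, ∑ m, ∑ o, F m o k l = ∑ k, ∑ l, ∑ m, ∑ o, F l m o k :=
    sum_rotate fun k l m o => F l m o k
  have r3 : ∑ k, ∑ l, ∑ m, ∑ o, F o k l m = ∑ k, ∑ l, ∑ m, ∑ o, F m o k l :=
    sum_rotate fun k l m o => F m o k l
  calc _ ≤ ∑ k, ∑ l, ∑ m, ∑ o, 1 / 4 * (F k l m o + F l m o k + F m o k l + F o k l m) :=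
        Finset.sum_le_sum fun k _ => Finset.sum_le_sum fun l _ => Finset.sum_le_sum fun m _ =>
          Finset.sum_le_sum fun o _ => hpoint k l m o
    _ = ∑ k, ∑ l, ∑ m, ∑ o, F k l m o := by
        simp only [← Finset.mul_sum, Finset.sum_add_distrib]
        rw [r3, r2, r1]
        ring
    _ ≤ _ := hpath

theorem sum_Icc_one_eq_sum_fin (d : ℕ) (f : ℤ → ℤ → ℝ)
    (hf : ∀ k l, f (k + 1) (l + 1) = f k l) :
    ∑ k ∈ Finset.Icc 1 (d : ℤ), ∑ l ∈ Finset.Icc 1 (d : ℤ), f k l =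
      ∑ k : Fin d, ∑ l : Fin d, f k l := by
  have h : ∀ h : ℤ → ℝ, ∑ k ∈ Finset.Icc 1 (d : ℤ), h k = ∑ k : Fin d, h (k + 1) := fun h => by
    symm
    refine Finset.sum_bij (fun k _ => (k : ℤ) + 1) (fun k _ => by rw [Finset.mem_Icc]; omega)
      (fun x _ y _ h => Fin.ext (by omega)) (fun m hm => ?_) fun _ _ => rfl
    rw [Finset.mem_Icc] at hm
    exact ⟨⟨(m - 1).toNat, by omega⟩, Finset.mem_univ _, by simp; omega⟩
  simp only [h, hf]

theorem sum_Icc_neg_succ (f : ℤ → ℝ) (d : ℕ) :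
    ∑ k ∈ Finset.Icc (-((d + 1 : ℕ) : ℤ)) (d + 1 : ℕ), f k =
      ∑ k ∈ Finset.Icc (-(d : ℤ)) d, f k + f (d + 1) + f (-(d + 1)) := by
  have h : Finset.Icc (-((d + 1 : ℕ) : ℤ)) (d + 1 : ℕ) =
      insert (-(d + 1) : ℤ) (insert (d + 1 : ℤ) (Finset.Icc (-(d : ℤ)) d)) := by
    ext k
    simp only [Finset.mem_insert, Finset.mem_Icc]
    omega
  rw [h, Finset.sum_insert, Finset.sum_insert]
  · ring
  all_goals simp only [Finset.mem_insert, Finset.mem_Icc]; omega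

theorem sum_Icc_neg_eq (f : ℤ → ℝ) (d : ℕ) :
    ∑ k ∈ Finset.Icc (-(d : ℤ)) d, f k =
      f 0 + ∑ k ∈ Finset.range d, (f (k + 1) + f (-(k + 1))) := by
  induction d with
  | zero => simp
  | succ d ih =>
    rw [sum_Icc_neg_succ, ih, Finset.sum_range_succ]
    ring

theorem sum_fin_sub_eq (f : ℤ → ℝ) (d : ℕ) :
    ∑ k : Fin d, ∑ l : Fin d, f ((k : ℤ) - l) =
      ∑ k ∈ Finset.Icc (-(d : ℤ)) d, ((d : ℝ) - |(k : ℝ)|) * f k := by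
  induction d with
  | zero => simp
  | succ d ih =>
    have hrefl : ∀ h : ℤ → ℝ, ∑ k : Fin d, h ((d : ℤ) - k) = ∑ k ∈ Finset.range d, h (k + 1) :=
      fun h => by
        rw [Fin.sum_univ_eq_sum_range (fun k => h ((d : ℤ) - k)), ← Finset.sum_range_reflect]
        refine Finset.sum_congr rfl fun k hk => ?_
        rw [Finset.mem_range] at hk
        congr 1
        omega
    have h1 := hrefl f
    have h2 := hrefl fun k => f (-k)
    simp only [neg_sub] at h2
    have h3 := sum_Icc_neg_eq f d
    rw [sum_Icc_neg_succ]
    simp only [Fin.sum_univ_castSucc, Fin.val_castSucc, Fin.val_last, Finset.sum_add_distrib, ih, h1,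
      h2, sub_self]
    have h4 : ∑ k ∈ Finset.Icc (-(d : ℤ)) d, (((d + 1 : ℕ) : ℝ) - |(k : ℝ)|) * f k =
        ∑ k ∈ Finset.Icc (-(d : ℤ)) d, ((d : ℝ) - |(k : ℝ)|) * f k +
          ∑ k ∈ Finset.Icc (-(d : ℤ)) d, f k := by
      rw [← Finset.sum_add_distrib]
      refine Finset.sum_congr rfl fun k _ => ?_
      push_cast
      ring
    have h5 : |(d : ℝ) + 1| = d + 1 := abs_of_nonneg (by positivity)
    rw [h4, h3, Finset.sum_add_distrib]
    push_cast
    rw [abs_neg, h5]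
    ring

theorem mul_sum_one_sub_abs_div (s : ℤ → ℝ) {d : ℕ} (hd : 1 ≤ d) :
    (d : ℝ) * ∑ k ∈ Finset.Icc (-(d : ℤ)) (d : ℤ), (1 - |(k : ℝ)| / d) * s k ^ 2 =
      ∑ k : Fin d, ∑ l : Fin d, s ((k : ℤ) - l) ^ 2 := by
  have hd' : (d : ℝ) ≠ 0 := by positivity
  rw [sum_fin_sub_eq (fun k => s k ^ 2), Finset.mul_sum]
  refine Finset.sum_congr rfl fun k _ => ?_
  field_simp

end Combinatorics

section PolynomialGrowth

variable {E F F' : Type*} [NormedAddCommGroup E] [NormedAddCommGroup F] [NormedAddCommGroup F']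

/-- A continuous function whose norm is bounded by a polynomial in the norm of its argument. -/
def HasPolynomialGrowth (f : E → F) : Prop :=
  Continuous f ∧ ∃ (C : ℝ) (k : ℕ), 0 ≤ C ∧ ∀ x, ‖f x‖ ≤ C * (1 + ‖x‖) ^ k

namespace HasPolynomialGrowth

theorem of_bounded {f : E → F} (hf : Continuous f) {C : ℝ} (hC : ∀ x, ‖f x‖ ≤ C) :
    HasPolynomialGrowth f :=
  ⟨hf, C, 0, (norm_nonneg _).trans (hC 0), by simpa using hC⟩

theorem const (c : F) : HasPolynomialGrowth fun _ : E => c :=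
  of_bounded continuous_const fun _ => le_rfl

theorem of_le {f : E → F} {g : E → F'} (hg : HasPolynomialGrowth g) (hf : Continuous f)
    {A B : ℝ} (hA : 0 ≤ A) (hB : 0 ≤ B) (h : ∀ x, ‖f x‖ ≤ A + B * ‖g x‖) :
    HasPolynomialGrowth f := by
  obtain ⟨-, C, k, hC, hk⟩ := hg
  refine ⟨hf, A + B * C, k, by positivity, fun x => (h x).trans ?_⟩
  have h1 : 1 ≤ (1 + ‖x‖) ^ k := one_le_pow₀ (by linarith [norm_nonneg x])
  calc A + B * ‖g x‖ ≤ A * (1 + ‖x‖) ^ k + B * (C * (1 + ‖x‖) ^ k) :=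
        add_le_add (le_mul_of_one_le_right hA h1) (mul_le_mul_of_nonneg_left (hk x) hB)
    _ = _ := by ring

theorem add {f g : E → F} (hf : HasPolynomialGrowth f) (hg : HasPolynomialGrowth g) :
    HasPolynomialGrowth fun x => f x + g x := by
  obtain ⟨hfc, C, k, hC, hk⟩ := hf
  obtain ⟨hgc, C', k', hC', hk'⟩ := hg
  refine ⟨hfc.add hgc, C + C', max k k', by positivity, fun x => (norm_add_le _ _).trans ?_⟩
  have h1 : 1 ≤ 1 + ‖x‖ := by linarith [norm_nonneg x]
  rw [add_mul]
  exact add_le_add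
    ((hk x).trans (mul_le_mul_of_nonneg_left (pow_le_pow_right₀ h1 (le_max_left _ _)) hC))
    ((hk' x).trans (mul_le_mul_of_nonneg_left (pow_le_pow_right₀ h1 (le_max_right _ _)) hC'))

theorem sum {α : Type*} {s : Finset α} {f : α → E → F}
    (hf : ∀ a ∈ s, HasPolynomialGrowth (f a)) : HasPolynomialGrowth fun x => ∑ a ∈ s, f a x := by
  classical
  induction s using Finset.induction_on with
  | empty => simpa using const (0 : F)
  | insert a s ha ih =>
    simp only [Finset.sum_insert ha]
    exact (hf a (Finset.mem_insert_self _ _)).add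
      (ih fun b hb => hf b (Finset.mem_insert_of_mem hb))

theorem clm_apply [NormedSpace ℝ F] [NormedSpace ℝ F'] {A : E → F →L[ℝ] F'} {v : E → F}
    (hA : HasPolynomialGrowth A) (hv : HasPolynomialGrowth v) :
    HasPolynomialGrowth fun x => A x (v x) := by
  obtain ⟨hAc, C, k, hC, hk⟩ := hA
  obtain ⟨hvc, C', k', hC', hk'⟩ := hv
  refine ⟨hAc.clm_apply hvc, C * C', k + k', by positivity, fun x => ?_⟩
  calc ‖A x (v x)‖ ≤ ‖A x‖ * ‖v x‖ := (A x).le_opNorm _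
    _ ≤ (C * (1 + ‖x‖) ^ k) * (C' * (1 + ‖x‖) ^ k') :=
        mul_le_mul (hk x) (hk' x) (norm_nonneg _) (by positivity)
    _ = _ := by rw [pow_add]; ring

theorem mul {f g : E → ℝ} (hf : HasPolynomialGrowth f) (hg : HasPolynomialGrowth g) :
    HasPolynomialGrowth fun x => f x * g x := by
  obtain ⟨hfc, C, k, hC, hk⟩ := hf
  obtain ⟨hgc, C', k', hC', hk'⟩ := hg
  refine ⟨hfc.mul hgc, C * C', k + k', by positivity, fun x => ?_⟩
  calc ‖f x * g x‖ = ‖f x‖ * ‖g x‖ := norm_mul _ _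
    _ ≤ (C * (1 + ‖x‖) ^ k) * (C' * (1 + ‖x‖) ^ k') :=
        mul_le_mul (hk x) (hk' x) (norm_nonneg _) (by positivity)
    _ = _ := by rw [pow_add]; ring

theorem const_mul {f : E → ℝ} (hf : HasPolynomialGrowth f) (c : ℝ) :
    HasPolynomialGrowth fun x => c * f x := (const c).mul hf

theorem sub {f g : E → ℝ} (hf : HasPolynomialGrowth f) (hg : HasPolynomialGrowth g) :
    HasPolynomialGrowth fun x => f x - g x := by
  simpa [sub_eq_add_neg] using hf.add (hg.const_mul (-1))

theorem norm {f : E → F} (hf : HasPolynomialGrowth f) : HasPolynomialGrowth fun x => ‖f x‖ :=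
  ⟨hf.1.norm, by simpa using hf.2⟩

theorem pi {κ : Type*} [Fintype κ] {f : E → κ → ℝ}
    (hf : ∀ i, HasPolynomialGrowth fun x => f x i) : HasPolynomialGrowth f := by
  have h := sum (s := Finset.univ) fun i _ => (hf i).norm
  refine h.of_le (continuous_pi fun i => (hf i).1) (le_refl 0) zero_le_one fun x => ?_
  rw [zero_add, one_mul, Real.norm_of_nonneg (by positivity)]
  exact (pi_norm_le_iff_of_nonneg (by positivity)).2 fun i =>
    Finset.single_le_sum (f := fun i => ‖f x i‖) (fun j _ => norm_nonneg _) (Finset.mem_univ i)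

theorem eval {ι : Type*} [Fintype ι] (i : ι) : HasPolynomialGrowth fun x : ι → ℝ => x i :=
  ⟨continuous_apply i, 1, 1, zero_le_one, fun x => by
    rw [one_mul, pow_one]
    linarith [norm_le_pi_norm x i]⟩

theorem integrable [NormedSpace ℝ E] [MeasurableSpace E] [BorelSpace E] [CompleteSpace E]
    [SecondCountableTopology E] {ν : Measure E} [IsGaussian ν] {f : E → ℝ}
    (hf : HasPolynomialGrowth f) : Integrable f ν := by
  obtain ⟨hfc, C, k, hC, hk⟩ := hf
  have h0 : MemLp (fun x : E => ‖x‖) k ν := (IsGaussian.memLp_id ν k (by simp)).norm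
  have h1 : MemLp (fun x : E => 1 + ‖x‖) k ν := (memLp_const (1 : ℝ)).add h0
  have h2 : Integrable (fun x : E => ‖1 + ‖x‖‖ ^ k) ν := h1.integrable_norm_pow'
  refine (h2.const_mul C).mono' hfc.aestronglyMeasurable (ae_of_all _ fun x => ?_)
  rw [Real.norm_of_nonneg (show 0 ≤ 1 + ‖x‖ by positivity)]
  exact hk x

end HasPolynomialGrowth

/-- Gaussian integration by parts for a centered Gaussian measure on `ι → ℝ` and functions of
polynomial growth. -/
theorem integral_eval_mul_eq_integral_lineDeriv {ι : Type*} [Fintype ι] {ν : Measure (ι → ℝ)}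
    [IsGaussian ν] (h0 : ∀ i, ∫ x, x i ∂ν = 0) (a : ι) {C : ι → ℝ}
    (hC : ∀ b, ∫ x, x a * x b ∂ν = C b) {φ φ' : (ι → ℝ) → ℝ}
    (hφ : ∀ x, HasLineDerivAt ℝ φ (φ' x) x C) (hφg : HasPolynomialGrowth φ)
    (hφ'g : HasPolynomialGrowth φ') :
    ∫ x, x a * φ x ∂ν = ∫ x, φ' x ∂ν :=
  integral_mul_eq_integral_lineDeriv (N := fun i (x : ι → ℝ) => x i) IsGaussian.hasGaussianLaw_id h0 a hC hφ
    hφg.1.measurable hφ'g.1.measurable hφg.integrable hφ'g.integrable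
    ((HasPolynomialGrowth.eval a).mul hφg).integrable

end PolynomialGrowth

section LineDeriv

variable {E F : Type*} [NormedAddCommGroup E] [NormedSpace ℝ E] [NormedAddCommGroup F]
  [NormedSpace ℝ F] {x v : E}

theorem hasLineDerivAt_eval {ι : Type*} [Fintype ι] (a : ι) (x v : ι → ℝ) :
    HasLineDerivAt ℝ (fun y : ι → ℝ => y a) (v a) x v :=
  (hasFDerivAt_apply (𝕜 := ℝ) a x).hasLineDerivAt v

theorem hasLineDerivAt_mul {f g : E → ℝ} {f' g' : ℝ} (hf : HasLineDerivAt ℝ f f' x v)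
    (hg : HasLineDerivAt ℝ g g' x v) :
    HasLineDerivAt ℝ (fun y => f y * g y) (f' * g x + f x * g') x v := by
  have h := HasDerivAt.mul hf hg
  simp only [zero_smul, add_zero] at h
  exact h

theorem hasLineDerivAt_add {f g : E → ℝ} {f' g' : ℝ} (hf : HasLineDerivAt ℝ f f' x v)
    (hg : HasLineDerivAt ℝ g g' x v) :
    HasLineDerivAt ℝ (fun y => f y + g y) (f' + g') x v :=
  HasDerivAt.add hf hg

theorem hasLineDerivAt_sub_const {f : E → ℝ} {f' : ℝ} (hf : HasLineDerivAt ℝ f f' x v) (c : ℝ) :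
    HasLineDerivAt ℝ (fun y => f y - c) f' x v :=
  HasDerivAt.sub_const c hf

theorem hasLineDerivAt_const_mul {f : E → ℝ} {f' : ℝ} (c : ℝ) (hf : HasLineDerivAt ℝ f f' x v) :
    HasLineDerivAt ℝ (fun y => c * f y) (c * f') x v :=
  HasDerivAt.const_mul c hf

theorem hasLineDerivAt_sum {α : Type*} {s : Finset α} {f : α → E → ℝ} {f' : α → ℝ}
    (hf : ∀ a ∈ s, HasLineDerivAt ℝ (f a) (f' a) x v) :
    HasLineDerivAt ℝ (fun y => ∑ a ∈ s, f a y) (∑ a ∈ s, f' a) x v :=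
  HasDerivAt.fun_sum hf

theorem hasLineDerivAt_comp_pi {κ : Type*} [Fintype κ] {h : (κ → ℝ) → ℝ} {M : E → κ → ℝ}
    {m : κ → ℝ} (hh : DifferentiableAt ℝ h (M x))
    (hM : ∀ p, HasLineDerivAt ℝ (fun y => M y p) (m p) x v) :
    HasLineDerivAt ℝ (fun y => h (M y)) (fderiv ℝ h (M x) m) x v := by
  have h1 : HasDerivAt (fun t : ℝ => M (x + t • v)) m 0 := hasDerivAt_pi.2 hM
  have h2 : HasFDerivAt h (fderiv ℝ h (M x)) (M (x + (0 : ℝ) • v)) := by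
    simpa using hh.hasFDerivAt
  exact h2.comp_hasDerivAt 0 h1

end LineDeriv

section Interpolation

variable {ι τ : Type*} [Fintype τ]

/-- The rows of the data matrix multiplied by the column covariance. -/
def rowCov (r : τ → τ → ℝ) (v : ι) (k : τ) (x : (ι × τ) ⊕ (ι × ι) → ℝ) : ℝ :=
  ∑ m, r k m * x (.inl (v, m))

/-- The entries of the data matrix sandwiching the column covariance. -/
def sandwich (r : τ → τ → ℝ) (j v : ι) (x : (ι × τ) ⊕ (ι × ι) → ℝ) : ℝ :=
  ∑ k, x (.inl (j, k)) * rowCov r v k x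

variable {r : τ → τ → ℝ} {σ : ℝ}

section

variable [DecidableEq ι]

/-- The symmetrized elementary matrices. -/
def symmSingle (i v : ι) (q : ι × ι) : ℝ :=
  (if i = q.1 then 1 else 0) * (if v = q.2 then 1 else 0)
    + (if i = q.2 then 1 else 0) * (if v = q.1 then 1 else 0)

/-- The covariance of the coordinate `Sum.inl (i, k)` with the whole vector. -/
def covInl (r : τ → τ → ℝ) (i : ι) (k : τ) : (ι × τ) ⊕ (ι × ι) → ℝ :=
  Sum.elim (fun q => (if i = q.1 then 1 else 0) * r k q.2) fun _ => 0

/-- The covariance of the coordinate `Sum.inr (i, v)` with the whole vector. -/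
def covInr (τ : Type*) (σ : ℝ) (i v : ι) : (ι × τ) ⊕ (ι × ι) → ℝ :=
  Sum.elim (fun _ => 0) fun q => symmSingle i v q * σ

theorem rowCov_covInr (v : ι) (l : τ) (i u : ι) : rowCov r v l (covInr τ σ i u) = 0 := by
  simp [rowCov, covInr]

theorem rowCov_covInl (v i : ι) (l k : τ) :
    rowCov r v l (covInl r i k : (ι × τ) ⊕ (ι × ι) → ℝ) =
      (if i = v then 1 else 0) * ∑ m, r l m * r k m := by
  simp only [rowCov, covInl, Sum.elim_inl, Finset.mul_sum]
  exact Finset.sum_congr rfl fun m _ => by ring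

/-- The normalized Wishart matrix, as a function of the coordinates `Sum.inl` of a vector. -/
noncomputable def wishart (x : (ι × τ) ⊕ (ι × ι) → ℝ) (p : ι × ι) : ℝ :=
  1 / Real.sqrt (Fintype.card τ) *
    (∑ k, x (.inl (p.1, k)) * x (.inl (p.2, k)) - if p.1 = p.2 then (Fintype.card τ : ℝ) else 0)

/-- The rotation between a Gaussian matrix and the normalized Wishart matrix. -/
noncomputable def interp (θ : ℝ) (x : (ι × τ) ⊕ (ι × ι) → ℝ) (p : ι × ι) : ℝ :=
  Real.sin θ * wishart x p + Real.cos θ * x (.inr p)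

/-- The velocity of the interpolation. -/
noncomputable def interpDeriv (θ : ℝ) (x : (ι × τ) ⊕ (ι × ι) → ℝ) (p : ι × ι) : ℝ :=
  Real.cos θ * wishart x p - Real.sin θ * x (.inr p)

theorem hasDerivAt_interp (θ : ℝ) (x : (ι × τ) ⊕ (ι × ι) → ℝ) :
    HasDerivAt (fun t => interp t x) (interpDeriv θ x) θ :=
  hasDerivAt_pi.2 fun p => by
    have h := ((Real.hasDerivAt_sin θ).mul_const (wishart x p)).add
      ((Real.hasDerivAt_cos θ).mul_const (x (.inr p)))
    refine h.congr_deriv ?_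
    rw [interpDeriv]
    ring

end

variable [Fintype ι]

theorem hasPolynomialGrowth_rowCov (v : ι) (k : τ) : HasPolynomialGrowth (rowCov (ι := ι) r v k) :=
  .sum fun _ _ => (HasPolynomialGrowth.eval _).const_mul _

theorem hasPolynomialGrowth_sandwich (j v : ι) : HasPolynomialGrowth (sandwich r j v) :=
  .sum fun k _ => (HasPolynomialGrowth.eval _).mul (hasPolynomialGrowth_rowCov v k)

theorem hasLineDerivAt_rowCov (v : ι) (l : τ) (x C : (ι × τ) ⊕ (ι × ι) → ℝ) :
    HasLineDerivAt ℝ (rowCov r v l) (rowCov r v l C) x C :=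
  hasLineDerivAt_sum fun _ _ => hasLineDerivAt_const_mul _ (hasLineDerivAt_eval _ _ _)

variable [DecidableEq ι]

/-- A centered Gaussian vector made of a matrix with independent rows of covariance `r`, and of an
independent symmetric Gaussian matrix of variance `σ`. -/
structure IsWishartModel (ν : Measure ((ι × τ) ⊕ (ι × ι) → ℝ)) (r : τ → τ → ℝ) (σ : ℝ) : Prop where
  isGaussian : IsGaussian ν
  integral_eval : ∀ a, ∫ x, x a ∂ν = 0
  integral_inl_inl : ∀ i k j l,
    ∫ x, x (.inl (i, k)) * x (.inl (j, l)) ∂ν = (if i = j then 1 else 0) * r k l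
  integral_inl_inr : ∀ a b, ∫ x, x (.inl a) * x (.inr b) ∂ν = 0
  integral_inr_inr : ∀ i v q, ∫ x, x (.inr (i, v)) * x (.inr q) ∂ν = symmSingle i v q * σ

variable {ν : Measure ((ι × τ) ⊕ (ι × ι) → ℝ)}

theorem IsWishartModel.integral_inl_mul (H : IsWishartModel ν r σ) (i : ι) (k : τ)
    {φ φ' : ((ι × τ) ⊕ (ι × ι) → ℝ) → ℝ} (hφ : ∀ x, HasLineDerivAt ℝ φ (φ' x) x (covInl r i k))
    (hφg : HasPolynomialGrowth φ) (hφ'g : HasPolynomialGrowth φ') :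
    ∫ x, x (.inl (i, k)) * φ x ∂ν = ∫ x, φ' x ∂ν := by
  have := H.isGaussian
  refine integral_eval_mul_eq_integral_lineDeriv H.integral_eval _ (fun b => ?_) hφ hφg hφ'g
  rcases b with ⟨j, l⟩ | q
  · exact H.integral_inl_inl i k j l
  · exact H.integral_inl_inr _ q

theorem IsWishartModel.integral_inr_mul (H : IsWishartModel ν r σ) (i v : ι)
    {φ φ' : ((ι × τ) ⊕ (ι × ι) → ℝ) → ℝ} (hφ : ∀ x, HasLineDerivAt ℝ φ (φ' x) x (covInr τ σ i v))
    (hφg : HasPolynomialGrowth φ) (hφ'g : HasPolynomialGrowth φ') :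
    ∫ x, x (.inr (i, v)) * φ x ∂ν = ∫ x, φ' x ∂ν := by
  have := H.isGaussian
  refine integral_eval_mul_eq_integral_lineDeriv H.integral_eval _ (fun b => ?_) hφ hφg hφ'g
  rcases b with a | q
  · simp only [mul_comm (_ : ℝ) (_ : ℝ), covInr, Sum.elim_inl]
    rw [← H.integral_inl_inr a (i, v)]
  · exact H.integral_inr_inr i v q

theorem hasPolynomialGrowth_wishart (p : ι × ι) :
    HasPolynomialGrowth fun x : (ι × τ) ⊕ (ι × ι) → ℝ => wishart x p :=
  ((HasPolynomialGrowth.sum fun _ _ => (HasPolynomialGrowth.eval _).mul (.eval _)).sub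
    (.const _)).const_mul _

theorem hasPolynomialGrowth_interp (θ : ℝ) :
    HasPolynomialGrowth (interp (ι := ι) (τ := τ) θ) :=
  .pi fun p => ((hasPolynomialGrowth_wishart p).const_mul _).add
    ((HasPolynomialGrowth.eval _).const_mul _)

theorem hasLineDerivAt_sandwich_covInr (j v i u : ι) (x : (ι × τ) ⊕ (ι × ι) → ℝ) :
    HasLineDerivAt ℝ (sandwich r j v) 0 x (covInr τ σ i u) := by
  have h : HasLineDerivAt ℝ (sandwich r j v) _ x (covInr τ σ i u) :=
    hasLineDerivAt_sum fun k _ =>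
      hasLineDerivAt_mul (hasLineDerivAt_eval (.inl (j, k)) x _) (hasLineDerivAt_rowCov v k x _)
  refine HasDerivAt.congr_deriv h ?_
  simp only [rowCov_covInr]
  simp [covInr]

theorem hasLineDerivAt_wishart_covInl (p : ι × ι) (i : ι) (k : τ)
    (x : (ι × τ) ⊕ (ι × ι) → ℝ) :
    HasLineDerivAt ℝ (fun y => wishart y p)
      (1 / Real.sqrt (Fintype.card τ) * ∑ v, rowCov r v k x * symmSingle i v p) x
      (covInl r i k) := by
  have h := hasLineDerivAt_const_mul (1 / Real.sqrt (Fintype.card τ)) (hasLineDerivAt_sub_const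
    (hasLineDerivAt_sum (s := Finset.univ) fun l _ => hasLineDerivAt_mul
      (hasLineDerivAt_eval (.inl (p.1, l)) x (covInl r i k))
      (hasLineDerivAt_eval (.inl (p.2, l)) x (covInl r i k)))
    (if p.1 = p.2 then (Fintype.card τ : ℝ) else 0))
  refine HasDerivAt.congr_deriv h ?_
  congr 1
  simp only [symmSingle, covInl, Sum.elim_inl, rowCov, mul_add, Finset.sum_add_distrib, mul_ite,
    mul_one, mul_zero, ite_mul, one_mul, zero_mul]
  simp [mul_comm (r k _)]

theorem hasLineDerivAt_interp_covInl (θ : ℝ) (p : ι × ι) (i : ι) (k : τ)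
    (x : (ι × τ) ⊕ (ι × ι) → ℝ) :
    HasLineDerivAt ℝ (fun y => interp θ y p)
      ((∑ v, (Real.sin θ * (1 / Real.sqrt (Fintype.card τ)) * rowCov r v k x) • symmSingle i v) p) x
      (covInl r i k) := by
  have h := hasLineDerivAt_add
    (hasLineDerivAt_const_mul (Real.sin θ) (hasLineDerivAt_wishart_covInl (r := r) p i k x))
    (hasLineDerivAt_const_mul (Real.cos θ) (hasLineDerivAt_eval (.inr p) x (covInl r i k)))
  refine HasDerivAt.congr_deriv h ?_
  simp only [covInl, Sum.elim_inr, mul_zero, add_zero, Finset.sum_apply, Pi.smul_apply, smul_eq_mul,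
    Finset.mul_sum, mul_assoc]

theorem hasLineDerivAt_interp_covInr (θ : ℝ) (p : ι × ι) (i v : ι) (x : (ι × τ) ⊕ (ι × ι) → ℝ) :
    HasLineDerivAt ℝ (fun y => interp θ y p) (((Real.cos θ * σ) • symmSingle i v) p) x
      (covInr τ σ i v) := by
  have hw : HasLineDerivAt ℝ (fun y => wishart y p) _ x (covInr τ σ i v) :=
    hasLineDerivAt_const_mul (1 / Real.sqrt (Fintype.card τ)) (hasLineDerivAt_sub_const
      (hasLineDerivAt_sum (s := Finset.univ) fun l _ => hasLineDerivAt_mul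
        (hasLineDerivAt_eval (.inl (p.1, l)) x (covInr τ σ i v))
        (hasLineDerivAt_eval (.inl (p.2, l)) x (covInr τ σ i v)))
      (if p.1 = p.2 then (Fintype.card τ : ℝ) else 0))
  have h := hasLineDerivAt_add (hasLineDerivAt_const_mul (Real.sin θ) hw)
    (hasLineDerivAt_const_mul (Real.cos θ) (hasLineDerivAt_eval (.inr p) x (covInr τ σ i v)))
  refine HasDerivAt.congr_deriv h ?_
  simp only [covInr, Sum.elim_inl, Sum.elim_inr, zero_mul, mul_zero, add_zero, Finset.sum_const_zero,
    zero_add, Pi.smul_apply, smul_eq_mul]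
  ring

section

variable {h : (ι × ι → ℝ) → ℝ} {K L : ℝ}

theorem hasPolynomialGrowth_comp_interp (hh : Continuous h) (hK : ∀ y, ‖h y‖ ≤ K) (θ : ℝ) :
    HasPolynomialGrowth fun x : (ι × τ) ⊕ (ι × ι) → ℝ => h (interp θ x) :=
  .of_bounded (hh.comp (hasPolynomialGrowth_interp θ).1) fun _ => hK _

theorem hasPolynomialGrowth_fderiv_interp (hh : ContDiff ℝ 1 h) (hL : ∀ y, ‖fderiv ℝ h y‖ ≤ L)
    (θ : ℝ) (w : ι × ι → ℝ) :
    HasPolynomialGrowth fun x : (ι × τ) ⊕ (ι × ι) → ℝ => fderiv ℝ h (interp θ x) w :=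
  (HasPolynomialGrowth.of_bounded ((hh.continuous_fderiv (by norm_num)).comp
    (hasPolynomialGrowth_interp θ).1) fun _ => hL _).clm_apply (.const w)

theorem IsWishartModel.integral_comp_interp_mul_wishart [Nonempty τ] (H : IsWishartModel ν r σ)
    (hr : ∀ k, r k k = 1)
    (hh : ContDiff ℝ 1 h) (hK : ∀ y, ‖h y‖ ≤ K) (hL : ∀ y, ‖fderiv ℝ h y‖ ≤ L) (θ : ℝ) (i j : ι) :
    Fintype.card τ * ∫ x, h (interp θ x) * wishart x (i, j) ∂ν =
      Real.sin θ * ∑ v, ∫ x, sandwich r j v x * fderiv ℝ h (interp θ x) (symmSingle i v) ∂ν := by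
  have := H.isGaussian
  have hg := hasPolynomialGrowth_comp_interp (τ := τ) hh.continuous hK θ
  have hq := fun v => hasPolynomialGrowth_fderiv_interp (τ := τ) hh hL θ (symmSingle i v)
  set c := 1 / Real.sqrt (Fintype.card τ) with hc
  have hcc : Fintype.card τ * c * c = 1 := by
    have h0 : (0 : ℝ) < Fintype.card τ := by exact_mod_cast Fintype.card_pos
    have h1 := Real.mul_self_sqrt h0.le
    have h2 := (Real.sqrt_pos.2 h0).ne'
    rw [hc]
    field_simp
    nlinarith
  have hterm : ∀ k v, HasPolynomialGrowth fun x : (ι × τ) ⊕ (ι × ι) → ℝ =>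
      x (.inl (j, k)) * rowCov r v k x * fderiv ℝ h (interp θ x) (symmSingle i v) := fun k v =>
    ((HasPolynomialGrowth.eval _).mul (hasPolynomialGrowth_rowCov v k)).mul (hq v)
  have hstein : ∀ k, ∫ x, x (.inl (i, k)) * (x (.inl (j, k)) * h (interp θ x)) ∂ν =
      (if i = j then 1 else 0) * ∫ x, h (interp θ x) ∂ν + Real.sin θ * c * ∑ v,
        ∫ x, x (.inl (j, k)) * rowCov r v k x * fderiv ℝ h (interp θ x) (symmSingle i v) ∂ν := by
    intro k
    rw [H.integral_inl_mul i k (φ' := fun x => (if i = j then 1 else 0) * h (interp θ x) +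
      Real.sin θ * c * ∑ v,
        x (.inl (j, k)) * rowCov r v k x * fderiv ℝ h (interp θ x) (symmSingle i v))
      (fun x => ?_) ((HasPolynomialGrowth.eval _).mul hg)
      ((hg.const_mul _).add ((HasPolynomialGrowth.sum fun v _ => hterm k v).const_mul _)),
      integral_add (hg.const_mul _).integrable
        ((HasPolynomialGrowth.sum fun v _ => hterm k v).const_mul _).integrable,
      integral_const_mul, integral_const_mul, integral_finsetSum _ fun v _ => (hterm k v).integrable]
    have hd := hasLineDerivAt_mul (hasLineDerivAt_eval (.inl (j, k)) x (covInl r i k))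
      (hasLineDerivAt_comp_pi (hh.differentiable (by norm_num) _)
        fun p => hasLineDerivAt_interp_covInl (r := r) θ p i k x)
    refine HasDerivAt.congr_deriv hd ?_
    simp only [covInl, Sum.elim_inl, hr, mul_one, map_sum, map_smul, smul_eq_mul, Finset.mul_sum]
    congr 1
    exact Finset.sum_congr rfl fun v _ => by ring
  have hsplit : ∀ x : (ι × τ) ⊕ (ι × ι) → ℝ, h (interp θ x) * wishart x (i, j) =
      c * (∑ k, x (.inl (i, k)) * (x (.inl (j, k)) * h (interp θ x)) -
        (if i = j then 1 else 0) * Fintype.card τ * h (interp θ x)) := fun x => by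
    simp only [wishart, ← mul_assoc, ← Finset.sum_mul]
    split_ifs <;> ring
  have hxx : ∀ k, HasPolynomialGrowth fun x : (ι × τ) ⊕ (ι × ι) → ℝ =>
      x (.inl (i, k)) * (x (.inl (j, k)) * h (interp θ x)) := fun k =>
    (HasPolynomialGrowth.eval _).mul ((HasPolynomialGrowth.eval _).mul hg)
  simp only [hsplit]
  rw [integral_const_mul, integral_sub (HasPolynomialGrowth.sum fun k _ => hxx k).integrable
    (hg.const_mul _).integrable, integral_const_mul, integral_finsetSum _ fun k _ => (hxx k).integrable]
  simp only [hstein, Finset.sum_add_distrib, Finset.sum_const, Finset.card_univ, nsmul_eq_mul,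
    ← Finset.mul_sum]
  rw [Finset.sum_comm]
  have hsand : ∀ v, ∑ k, ∫ x, x (.inl (j, k)) * rowCov r v k x *
      fderiv ℝ h (interp θ x) (symmSingle i v) ∂ν =
      ∫ x, sandwich r j v x * fderiv ℝ h (interp θ x) (symmSingle i v) ∂ν := fun v => by
    rw [← integral_finsetSum _ fun k _ => (hterm k v).integrable]
    simp only [sandwich, Finset.sum_mul]
  simp only [hsand]
  linear_combination (Real.sin θ * ∑ v, ∫ x, sandwich r j v x *
    fderiv ℝ h (interp θ x) (symmSingle i v) ∂ν) * hcc

theorem IsWishartModel.integral_inr_mul_sandwich (H : IsWishartModel ν r σ)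
    (hh : ContDiff ℝ 1 h) (hK : ∀ y, ‖h y‖ ≤ K) (hL : ∀ y, ‖fderiv ℝ h y‖ ≤ L) (θ : ℝ) (i j v : ι) :
    ∫ x, x (.inr (i, v)) * (sandwich r j v x * h (interp θ x)) ∂ν =
      Real.cos θ * σ *
        ∫ x, sandwich r j v x * fderiv ℝ h (interp θ x) (symmSingle i v) ∂ν := by
  have hg := hasPolynomialGrowth_comp_interp (τ := τ) hh.continuous hK θ
  have hq := hasPolynomialGrowth_fderiv_interp (τ := τ) hh hL θ (symmSingle i v)
  have hY := hasPolynomialGrowth_sandwich (r := r) j v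
  rw [← integral_const_mul]
  refine H.integral_inr_mul i v (fun x => ?_) (hY.mul hg) ((hY.mul hq).const_mul _)
  have hd := hasLineDerivAt_mul (hasLineDerivAt_sandwich_covInr (r := r) (σ := σ) j v i v x)
    (hasLineDerivAt_comp_pi (hh.differentiable (by norm_num) _)
      fun p => hasLineDerivAt_interp_covInr (σ := σ) θ p i v x)
  refine HasDerivAt.congr_deriv hd ?_
  simp only [map_smul, smul_eq_mul]
  ring

theorem IsWishartModel.integral_comp_interp_mul_sub [Nonempty τ] (H : IsWishartModel ν r σ)
    (hr : ∀ k, r k k = 1)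
    (hh : ContDiff ℝ 1 h) (hK : ∀ y, ‖h y‖ ≤ K) (hL : ∀ y, ‖fderiv ℝ h y‖ ≤ L) (θ : ℝ) (p : ι × ι) :
    Fintype.card τ * σ *
        ∫ x, h (interp θ x) * (Real.cos θ * wishart x p - Real.sin θ * x (.inr p)) ∂ν =
      Real.sin θ * ∫ x, h (interp θ x) * ∑ v, x (.inr (p.1, v)) *
        (sandwich r p.2 v x - if p.2 = v then Fintype.card τ * σ else 0) ∂ν := by
  have := H.isGaussian
  have hg := hasPolynomialGrowth_comp_interp (τ := τ) hh.continuous hK θ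
  have hG : ∀ v, HasPolynomialGrowth fun x : (ι × τ) ⊕ (ι × ι) → ℝ =>
      x (.inr (p.1, v)) * (sandwich r p.2 v x * h (interp θ x)) := fun v =>
    (HasPolynomialGrowth.eval _).mul ((hasPolynomialGrowth_sandwich p.2 v).mul hg)
  have hgp : HasPolynomialGrowth fun x : (ι × τ) ⊕ (ι × ι) → ℝ => h (interp θ x) * x (.inr p) :=
    hg.mul (.eval _)
  have hl : ∀ x : (ι × τ) ⊕ (ι × ι) → ℝ,
      h (interp θ x) * (Real.cos θ * wishart x p - Real.sin θ * x (.inr p)) =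
        Real.cos θ * (h (interp θ x) * wishart x p) - Real.sin θ * (h (interp θ x) * x (.inr p)) :=
    fun x => by ring
  have hrhs : ∀ x : (ι × τ) ⊕ (ι × ι) → ℝ, h (interp θ x) * ∑ v, x (.inr (p.1, v)) *
        (sandwich r p.2 v x - if p.2 = v then Fintype.card τ * σ else 0) =
      ∑ v, x (.inr (p.1, v)) * (sandwich r p.2 v x * h (interp θ x)) -
        Fintype.card τ * σ * (h (interp θ x) * x (.inr p)) := fun x => by
    simp only [mul_sub, Finset.sum_sub_distrib, mul_ite, mul_zero, Finset.sum_ite_eq,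
      Finset.mem_univ, if_true, Finset.mul_sum]
    congr 1
    · exact Finset.sum_congr rfl fun v _ => by ring
    · ring
  simp only [hl, hrhs]
  rw [integral_sub ((hg.mul (hasPolynomialGrowth_wishart p)).const_mul _).integrable
      (hgp.const_mul _).integrable,
    integral_sub (HasPolynomialGrowth.sum fun v _ => hG v).integrable (hgp.const_mul _).integrable,
    integral_const_mul, integral_const_mul, integral_const_mul,
    integral_finsetSum _ fun v _ => (hG v).integrable]
  simp only [H.integral_inr_mul_sandwich hh hK hL]
  rw [← Finset.mul_sum]
  have hX := H.integral_comp_interp_mul_wishart hr hh hK hL θ p.1 p.2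
  linear_combination (Real.cos θ * σ) * hX

end

theorem hasLineDerivAt_sandwich_covInl (hs : ∀ k l, r k l = r l k) (j v : ι) (k : τ)
    (x : (ι × τ) ⊕ (ι × ι) → ℝ) :
    HasLineDerivAt ℝ (sandwich r j v)
      ((1 + if j = v then 1 else 0) * ∑ l, r k l * rowCov r v l x) x (covInl r j k) := by
  have h : HasLineDerivAt ℝ (sandwich r j v) _ x (covInl r j k) :=
    hasLineDerivAt_sum fun l _ =>
      hasLineDerivAt_mul (hasLineDerivAt_eval (.inl (j, l)) x _) (hasLineDerivAt_rowCov v l x _)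
  refine HasDerivAt.congr_deriv h ?_
  simp only [rowCov_covInl, Finset.sum_add_distrib, add_mul, one_mul]
  congr 1
  · simp [covInl]
  · split_ifs with hjv
    · subst hjv
      simp only [one_mul, rowCov, Finset.mul_sum]
      rw [Finset.sum_comm]
      exact Finset.sum_congr rfl fun l _ => Finset.sum_congr rfl fun m _ => by rw [hs m l]; ring
    · simp

theorem IsWishartModel.integral_rowCov_mul_rowCov (H : IsWishartModel ν r σ) (v : ι) (k l : τ) :
    ∫ x, rowCov r v k x * rowCov r v l x ∂ν = ∑ m, ∑ o, r k m * r l o * r m o := by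
  have := H.isGaussian
  have hg : ∀ m o, HasPolynomialGrowth fun x : (ι × τ) ⊕ (ι × ι) → ℝ =>
      r k m * r l o * (x (.inl (v, m)) * x (.inl (v, o))) := fun m o =>
    ((HasPolynomialGrowth.eval _).mul (.eval _)).const_mul _
  calc ∫ x, rowCov r v k x * rowCov r v l x ∂ν =
        ∫ x, ∑ m, ∑ o, r k m * r l o * (x (.inl (v, m)) * x (.inl (v, o))) ∂ν := by
        simp only [rowCov, Finset.sum_mul_sum]
        refine integral_congr_ae (ae_of_all _ fun x => ?_)
        exact Finset.sum_congr rfl fun m _ => Finset.sum_congr rfl fun o _ => by ring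
    _ = _ := by
        rw [integral_finsetSum _ fun m _ => (HasPolynomialGrowth.sum fun o _ => hg m o).integrable]
        refine Finset.sum_congr rfl fun m _ => ?_
        rw [integral_finsetSum _ fun o _ => (hg m o).integrable]
        refine Finset.sum_congr rfl fun o _ => ?_
        rw [integral_const_mul, H.integral_inl_inl, if_pos rfl, one_mul]

theorem IsWishartModel.integral_sq_sandwich_sub (H : IsWishartModel ν r σ)
    (hs : ∀ k l, r k l = r l k) {D : ℝ} (hD : D = ∑ k, ∑ l, r k l ^ 2) (j v : ι) :
    ∫ x, (sandwich r j v x - if j = v then D else 0) ^ 2 ∂ν =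
      (1 + if j = v then 1 else 0) * ∑ k, ∑ l, ∑ m, ∑ o, r k l * r l m * r m o * r o k := by
  have := H.isGaussian
  set c := if j = v then D else 0 with hc
  have hR := fun k => hasPolynomialGrowth_rowCov (ι := ι) (r := r) v k
  have hZ : HasPolynomialGrowth fun x => sandwich r j v x - c :=
    (hasPolynomialGrowth_sandwich (r := r) j v).sub (.const c)
  have hRZ := fun k => (hR k).mul hZ
  have hRR := fun k l => ((hR k).mul (hR l)).const_mul (r k l)
  have hsum := fun k => (HasPolynomialGrowth.sum (s := Finset.univ) fun l _ => hRR k l).const_mul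
    (1 + if j = v then 1 else 0)
  have hstein : ∀ k, ∫ x, x (.inl (j, k)) * (rowCov r v k x * (sandwich r j v x - c)) ∂ν =
      (if j = v then 1 else 0) * (∑ m, r k m ^ 2) * ∫ x, (sandwich r j v x - c) ∂ν +
        (1 + if j = v then 1 else 0) * ∑ l, r k l * ∫ x, rowCov r v k x * rowCov r v l x ∂ν := by
    intro k
    rw [H.integral_inl_mul j k (φ' := fun x => (if j = v then 1 else 0) * (∑ m, r k m ^ 2) *
      (sandwich r j v x - c) + (1 + if j = v then 1 else 0) *
        ∑ l, r k l * (rowCov r v k x * rowCov r v l x)) (fun x => ?_) (hRZ k)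
      ((hZ.const_mul _).add (hsum k)),
      integral_add (hZ.const_mul _).integrable (hsum k).integrable, integral_const_mul,
      integral_const_mul, integral_finsetSum _ fun l _ => (hRR k l).integrable]
    · simp only [integral_const_mul]
    · have hd := hasLineDerivAt_mul (hasLineDerivAt_rowCov (r := r) v k x (covInl r j k))
        (hasLineDerivAt_sub_const (hasLineDerivAt_sandwich_covInl hs j v k x) c)
      refine HasDerivAt.congr_deriv hd ?_
      simp only [rowCov_covInl, sq, Finset.mul_sum]
      congr 1
      exact Finset.sum_congr rfl fun l _ => by ring
  have hsplit : ∀ x, (sandwich r j v x - c) ^ 2 =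
      ∑ k, x (.inl (j, k)) * (rowCov r v k x * (sandwich r j v x - c)) -
        c * (sandwich r j v x - c) := fun x => by
    simp only [← mul_assoc, ← Finset.sum_mul]
    rw [← sandwich]
    ring
  have hXRZ := fun k => (HasPolynomialGrowth.eval (.inl (j, k))).mul (hRZ k)
  simp only [hsplit]
  rw [integral_sub (HasPolynomialGrowth.sum fun k _ => hXRZ k).integrable (hZ.const_mul _).integrable,
    integral_const_mul, integral_finsetSum _ fun k _ => (hXRZ k).integrable]
  simp only [hstein, Finset.sum_add_distrib, ← Finset.mul_sum, ← Finset.sum_mul]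
  have hcD : c = (if j = v then 1 else 0) * ∑ k, ∑ m, r k m ^ 2 := by rw [hc, hD]; simp
  rw [hcD, add_sub_cancel_left]
  congr 1
  simp only [H.integral_rowCov_mul_rowCov, Finset.mul_sum]
  refine Finset.sum_congr rfl fun k _ => Finset.sum_congr rfl fun l _ => ?_
  rw [Finset.sum_comm]
  refine Finset.sum_congr rfl fun o _ => Finset.sum_congr rfl fun m _ => ?_
  rw [hs m k, hs o m]
  ring

theorem IsWishartModel.integral_sq_sum_inr_mul (H : IsWishartModel ν r σ)
    {Z : ι → ((ι × τ) ⊕ (ι × ι) → ℝ) → ℝ} (hZ : ∀ v, HasPolynomialGrowth (Z v))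
    (hZd : ∀ v i u x, HasLineDerivAt ℝ (Z v) 0 x (covInr τ σ i u)) (i : ι) :
    ∫ x, (∑ v, x (.inr (i, v)) * Z v x) ^ 2 ∂ν =
      σ * ∑ v, (1 + if i = v then 1 else 0) * ∫ x, Z v x ^ 2 ∂ν := by
  have := H.isGaussian
  have hG : ∀ v w, HasPolynomialGrowth fun x => x (.inr (i, v)) *
      (x (.inr (i, w)) * (Z v x * Z w x)) := fun v w =>
    (HasPolynomialGrowth.eval _).mul ((HasPolynomialGrowth.eval _).mul ((hZ v).mul (hZ w)))
  have hstein : ∀ v w, ∫ x, x (.inr (i, v)) * (x (.inr (i, w)) * (Z v x * Z w x)) ∂ν =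
      symmSingle i v (i, w) * σ * ∫ x, Z v x * Z w x ∂ν := fun v w => by
    rw [← integral_const_mul]
    refine H.integral_inr_mul i v (fun x => ?_) ((HasPolynomialGrowth.eval _).mul ((hZ v).mul (hZ w)))
      (((hZ v).mul (hZ w)).const_mul _)
    have hd := hasLineDerivAt_mul (hasLineDerivAt_eval (.inr (i, w)) x (covInr τ σ i v))
      (hasLineDerivAt_mul (hZd v i v x) (hZd w i v x))
    refine HasDerivAt.congr_deriv hd ?_
    simp [covInr]
  calc ∫ x, (∑ v, x (.inr (i, v)) * Z v x) ^ 2 ∂ν =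
        ∫ x, ∑ v, ∑ w, x (.inr (i, v)) * (x (.inr (i, w)) * (Z v x * Z w x)) ∂ν := by
        refine integral_congr_ae (ae_of_all _ fun x => ?_)
        simp only [sq, Finset.sum_mul_sum]
        exact Finset.sum_congr rfl fun m _ => Finset.sum_congr rfl fun o _ => by ring
    _ = ∑ v, ∑ w, symmSingle i v (i, w) * σ * ∫ x, Z v x * Z w x ∂ν := by
        rw [integral_finsetSum _ fun v _ => (HasPolynomialGrowth.sum fun w _ => hG v w).integrable]
        refine Finset.sum_congr rfl fun v _ => ?_
        rw [integral_finsetSum _ fun w _ => (hG v w).integrable]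
        exact Finset.sum_congr rfl fun w _ => hstein v w
    _ = _ := by
        rw [Finset.mul_sum]
        refine Finset.sum_congr rfl fun v _ => ?_
        rw [Finset.sum_eq_single v]
        · simp only [symmSingle, if_true, sq, eq_comm]
          split_ifs <;> ring
        · intro w _ hw
          have hw' : v ≠ w := hw.symm
          simp only [symmSingle, hw', if_true, if_false]
          split_ifs with h1 h2
          · exact absurd (h2.trans h1) hw'
          all_goals simp
        · simp

theorem sq_integral_le_integral_sq {E : Type*} [MeasurableSpace E] {ν : Measure E}
    [IsProbabilityMeasure ν] {F : E → ℝ} (hF : Integrable F ν)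
    (hF2 : Integrable (fun x => F x ^ 2) ν) : (∫ x, F x ∂ν) ^ 2 ≤ ∫ x, F x ^ 2 ∂ν := by
  have h := variance_eq_sub ((memLp_two_iff_integrable_sq hF.aestronglyMeasurable).2 hF2)
  have h0 := variance_nonneg F ν
  rw [h] at h0
  simpa using h0

/-- The remainder produced by the two integrations by parts along the interpolation. -/
theorem IsWishartModel.sum_integral_sq_le (H : IsWishartModel ν r σ) (hσ : 0 ≤ σ)
    (hs : ∀ k l, r k l = r l k) {D : ℝ} (hD : D = ∑ k, ∑ l, r k l ^ 2) {T : ℝ}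
    (hT : ∑ k, ∑ l, ∑ m, ∑ o, r k l * r l m * r m o * r o k ≤ T) :
    ∑ p : ι × ι, ∫ x, (∑ v, x (.inr (p.1, v)) *
      (sandwich r p.2 v x - if p.2 = v then D else 0)) ^ 2 ∂ν ≤
      4 * Fintype.card ι ^ 3 * σ * T := by
  have hle : ∀ (j v : ι), ∫ x, (sandwich r j v x - if j = v then D else 0) ^ 2 ∂ν ≤ 2 * T := by
    intro j v
    have h0 : 0 ≤ ∫ x, (sandwich r j v x - if j = v then D else 0) ^ 2 ∂ν :=
      integral_nonneg fun x => sq_nonneg _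
    rw [H.integral_sq_sandwich_sub hs hD] at h0 ⊢
    split_ifs at h0 ⊢ <;> linarith
  have hterm : ∀ p : ι × ι, ∫ x, (∑ v, x (.inr (p.1, v)) *
      (sandwich r p.2 v x - if p.2 = v then D else 0)) ^ 2 ∂ν ≤
      4 * Fintype.card ι * σ * T := by
    intro p
    rw [H.integral_sq_sum_inr_mul
      (fun v => (hasPolynomialGrowth_sandwich p.2 v).sub (.const _))
      (fun v i u x => hasLineDerivAt_sub_const (hasLineDerivAt_sandwich_covInr p.2 v i u x) _)]
    calc _ ≤ σ * ∑ _v : ι, 2 * (2 * T) := by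
          refine mul_le_mul_of_nonneg_left (Finset.sum_le_sum fun v _ => ?_) hσ
          refine mul_le_mul ?_ (hle _ _) (integral_nonneg fun x => sq_nonneg _) zero_le_two
          split_ifs <;> norm_num
      _ = _ := by
          rw [Finset.sum_const, Finset.card_univ, nsmul_eq_mul]
          ring
  calc _ ≤ ∑ _p : ι × ι, 4 * Fintype.card ι * σ * T := Finset.sum_le_sum fun p _ => hterm p
    _ = _ := by
        rw [Finset.sum_const, Finset.card_univ, nsmul_eq_mul, Fintype.card_prod]
        push_cast
        ring

section

variable {f : (ι × ι → ℝ) → ℝ} {L : ℝ}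

theorem fderiv_eq_sum_single {κ : Type*} [Fintype κ] [DecidableEq κ] (A : (κ → ℝ) →L[ℝ] ℝ)
    (w : κ → ℝ) : A w = ∑ p, A (Pi.single p 1) * w p := by
  conv_lhs => rw [pi_eq_sum_univ' w]
  simp only [map_sum, map_smul, smul_eq_mul, mul_comm]

theorem norm_fderiv_le_of_abs_sub_le {κ : Type*} [Fintype κ] {f : (κ → ℝ) → ℝ}
    (hf : ∀ x y, |f x - f y| ≤ Real.sqrt (∑ i, (x i - y i) ^ 2)) (x : κ → ℝ) :
    ‖fderiv ℝ f x‖ ≤ NNReal.sqrt (Fintype.card κ) :=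
  norm_fderiv_le_of_lipschitz ℝ (lipschitzWith_of_abs_sub_le_euclidean hf)

theorem hasPolynomialGrowth_interpDeriv (θ : ℝ) :
    HasPolynomialGrowth (interpDeriv (ι := ι) (τ := τ) θ) :=
  .pi fun p => ((hasPolynomialGrowth_wishart p).const_mul _).sub
    ((HasPolynomialGrowth.eval _).const_mul _)

theorem IsWishartModel.abs_integral_fderiv_interp_le [Nonempty τ] (H : IsWishartModel ν r σ)
    (hσ : 0 < σ) (hr : ∀ k, r k k = 1) (hs : ∀ k l, r k l = r l k)
    (hD : Fintype.card τ * σ = ∑ k, ∑ l, r k l ^ 2) {b : ℝ}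
    (hT : ∑ k, ∑ l, ∑ m, ∑ o, r k l * r l m * r m o * r o k ≤ Fintype.card τ * b)
    (hf : ContDiff ℝ 2 f) (hfl : ∀ x y, |f x - f y| ≤ Real.sqrt (∑ p, (x p - y p) ^ 2))
    (hL : ∀ x, ‖fderiv ℝ (fderiv ℝ f) x‖ ≤ L) (θ : ℝ) :
    |∫ x, fderiv ℝ f (interp θ x) (interpDeriv θ x) ∂ν| ≤
      Real.sqrt (4 * Fintype.card ι ^ 3 * b / (Fintype.card τ * σ)) := by
  have := H.isGaussian
  have hd0 : (0 : ℝ) < Fintype.card τ := by exact_mod_cast Fintype.card_pos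
  set D := Fintype.card τ * σ with hDdef
  have hD0 : 0 < D := by positivity
  have hf1 : ContDiff ℝ 1 (fderiv ℝ f) := hf.fderiv_right (by norm_num)
  have hdiff : Differentiable ℝ (fderiv ℝ f) := hf1.differentiable (by norm_num)
  set h : ι × ι → (ι × ι → ℝ) → ℝ := fun p y => fderiv ℝ f y (Pi.single p 1) with hh
  have hh1 : ∀ p, ContDiff ℝ 1 (h p) := fun p => hf1.clm_apply contDiff_const
  have hone : ∀ p : ι × ι, ‖(Pi.single p 1 : ι × ι → ℝ)‖ ≤ 1 := fun p => by
    rw [Pi.norm_single, norm_one]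
  have hhK : ∀ p y, ‖h p y‖ ≤ NNReal.sqrt (Fintype.card (ι × ι)) := fun p y =>
    ((fderiv ℝ f y).le_of_opNorm_le (norm_fderiv_le_of_abs_sub_le hfl y) _).trans
      (mul_le_of_le_one_right (NNReal.coe_nonneg _) (hone p))
  have hhL : ∀ p y, ‖fderiv ℝ (h p) y‖ ≤ L := fun p y => by
    have hL0 : 0 ≤ L := (norm_nonneg (fderiv ℝ (fderiv ℝ f) y)).trans (hL y)
    refine ContinuousLinearMap.opNorm_le_bound _ hL0 fun w => ?_
    have he : fderiv ℝ (h p) y w = fderiv ℝ (fderiv ℝ f) y w (Pi.single p 1) := by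
      rw [hh, fderiv_clm_apply (hdiff y) (differentiableAt_const _)]
      simp
    rw [he]
    calc _ ≤ ‖fderiv ℝ (fderiv ℝ f) y w‖ * ‖(Pi.single p 1 : ι × ι → ℝ)‖ :=
          ContinuousLinearMap.le_opNorm _ _
      _ ≤ ‖fderiv ℝ (fderiv ℝ f) y w‖ := mul_le_of_le_one_right (norm_nonneg _) (hone p)
      _ ≤ L * ‖w‖ := ContinuousLinearMap.le_of_opNorm_le _ (hL y) w
  have hhg := fun p => hasPolynomialGrowth_comp_interp (τ := τ) (hh1 p).continuous (hhK p) θ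
  set A : ι × ι → ((ι × τ) ⊕ (ι × ι) → ℝ) → ℝ := fun p x => ∑ v, x (.inr (p.1, v)) *
    (sandwich r p.2 v x - if p.2 = v then D else 0) with hA
  have hAg : ∀ p, HasPolynomialGrowth (A p) := fun p => .sum fun v _ =>
    (HasPolynomialGrowth.eval _).mul ((hasPolynomialGrowth_sandwich p.2 v).sub (.const _))
  have hV : ∀ p, HasPolynomialGrowth fun x : (ι × τ) ⊕ (ι × ι) → ℝ => interpDeriv θ x p := fun p =>
    ((hasPolynomialGrowth_wishart p).const_mul _).sub ((HasPolynomialGrowth.eval _).const_mul _)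
  have hFg : HasPolynomialGrowth fun x => ∑ p, h p (interp θ x) * A p x :=
    .sum fun p _ => (hhg p).mul (hAg p)
  have hkey : D * ∫ x, fderiv ℝ f (interp θ x) (interpDeriv θ x) ∂ν =
      Real.sin θ * ∫ x, ∑ p, h p (interp θ x) * A p x ∂ν := by
    have he : ∀ x : (ι × τ) ⊕ (ι × ι) → ℝ, fderiv ℝ f (interp θ x) (interpDeriv θ x) =
      ∑ p, h p (interp θ x) * interpDeriv θ x p := fun x => fderiv_eq_sum_single _ _
    simp only [he]
    rw [integral_finsetSum _ fun p _ => ((hhg p).mul (hV p)).integrable,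
      integral_finsetSum _ fun p _ => ((hhg p).mul (hAg p)).integrable, Finset.mul_sum,
      Finset.mul_sum]
    exact Finset.sum_congr rfl fun p _ =>
      H.integral_comp_interp_mul_sub hr (hh1 p) (hhK p) (hhL p) θ p
  have hsq : (∫ x, ∑ p, h p (interp θ x) * A p x ∂ν) ^ 2 ≤
      4 * Fintype.card ι ^ 3 * σ * (Fintype.card τ * b) := by
    have hF2 : HasPolynomialGrowth fun x => (∑ p, h p (interp θ x) * A p x) ^ 2 := by
      simpa only [sq] using hFg.mul hFg
    have hA2 : ∀ p, HasPolynomialGrowth fun x => A p x ^ 2 := fun p => by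
      simpa only [sq] using (hAg p).mul (hAg p)
    calc _ ≤ ∫ x, (∑ p, h p (interp θ x) * A p x) ^ 2 ∂ν :=
          sq_integral_le_integral_sq hFg.integrable hF2.integrable
      _ ≤ ∫ x, ∑ p, A p x ^ 2 ∂ν := by
          refine integral_mono hF2.integrable
            (HasPolynomialGrowth.sum fun p _ => hA2 p).integrable fun x => ?_
          refine (Finset.sum_mul_sq_le_sq_mul_sq _ _ _).trans ?_
          refine mul_le_of_le_one_left (Finset.sum_nonneg fun p _ => sq_nonneg _) ?_
          exact sum_sq_fderiv_single_le_one (hf.differentiable (by norm_num)) hfl _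
      _ = ∑ p, ∫ x, A p x ^ 2 ∂ν := integral_finsetSum _ fun p _ => (hA2 p).integrable
      _ ≤ _ := H.sum_integral_sq_le hσ.le hs hD hT
  refine Real.abs_le_sqrt ?_
  rw [le_div_iff₀ hD0]
  refine le_of_mul_le_mul_right ?_ hD0
  calc _ = (D * ∫ x, fderiv ℝ f (interp θ x) (interpDeriv θ x) ∂ν) ^ 2 := by ring
    _ = Real.sin θ ^ 2 * (∫ x, ∑ p, h p (interp θ x) * A p x ∂ν) ^ 2 := by rw [hkey, mul_pow]
    _ ≤ 1 * (4 * Fintype.card ι ^ 3 * σ * (Fintype.card τ * b)) :=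
        mul_le_mul (Real.sin_sq_le_one θ) hsq (sq_nonneg _) zero_le_one
    _ = _ := by rw [hDdef]; ring

theorem hasDerivAt_integral_comp_interp [IsGaussian ν] (hf : ContDiff ℝ 1 f)
    (hfl : ∀ x y, |f x - f y| ≤ Real.sqrt (∑ p, (x p - y p) ^ 2)) (θ : ℝ) :
    HasDerivAt (fun t => ∫ x, f (interp t x) ∂ν)
      (∫ x, fderiv ℝ f (interp θ x) (interpDeriv θ x) ∂ν) θ := by
  have hlip := lipschitzWith_of_abs_sub_le_euclidean hfl
  set K := NNReal.sqrt (Fintype.card (ι × ι)) with hK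
  have hfg : ∀ t, HasPolynomialGrowth fun x : (ι × τ) ⊕ (ι × ι) → ℝ => f (interp t x) := fun t =>
    (hasPolynomialGrowth_interp t).of_le (hf.continuous.comp (hasPolynomialGrowth_interp t).1)
      (norm_nonneg (f 0)) K.coe_nonneg fun x => by
        have h1 := hlip.norm_sub_le (interp t x) 0
        rw [sub_zero] at h1
        linarith [norm_le_norm_add_norm_sub (f 0) (f (interp t x)), norm_sub_rev (f 0) (f (interp t x))]
  have hf'g : HasPolynomialGrowth fun x : (ι × τ) ⊕ (ι × ι) → ℝ =>
      fderiv ℝ f (interp θ x) (interpDeriv θ x) :=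
    (HasPolynomialGrowth.of_bounded ((hf.continuous_fderiv (by norm_num)).comp
      (hasPolynomialGrowth_interp θ).1) fun x => norm_fderiv_le_of_abs_sub_le hfl _).clm_apply
        (hasPolynomialGrowth_interpDeriv θ)
  have hW : HasPolynomialGrowth fun x : (ι × τ) ⊕ (ι × ι) → ℝ => ∑ p, ‖wishart x p‖ :=
    .sum fun p _ => (hasPolynomialGrowth_wishart p).norm
  have hG : HasPolynomialGrowth fun x : (ι × τ) ⊕ (ι × ι) → ℝ => ∑ p : ι × ι, ‖x (.inr p)‖ :=
    .sum fun p _ => (HasPolynomialGrowth.eval _).norm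
  refine (hasDerivAt_integral_of_dominated_loc_of_deriv_le (s := Set.univ)
    (F' := fun t x => fderiv ℝ f (interp t x) (interpDeriv t x)) Filter.univ_mem
    (Filter.Eventually.of_forall fun t => (hfg t).1.aestronglyMeasurable) (hfg θ).integrable
    hf'g.1.aestronglyMeasurable (ae_of_all _ fun x t _ => ?_) ((hW.add hG).const_mul K).integrable
    (ae_of_all _ fun x t _ => ?_)).2
  · refine ((fderiv ℝ f _).le_of_opNorm_le (norm_fderiv_le_of_abs_sub_le hfl _) _).trans ?_
    refine mul_le_mul_of_nonneg_left ?_ K.coe_nonneg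
    refine (pi_norm_le_iff_of_nonneg (by positivity)).2 fun p => ?_
    rw [interpDeriv]
    refine (norm_sub_le _ _).trans (add_le_add ?_ ?_)
    · rw [norm_mul]
      refine (mul_le_of_le_one_left (norm_nonneg _) (Real.abs_cos_le_one t)).trans ?_
      exact Finset.single_le_sum (f := fun p => ‖wishart x p‖) (fun _ _ => norm_nonneg _)
        (Finset.mem_univ p)
    · rw [norm_mul]
      refine (mul_le_of_le_one_left (norm_nonneg _) (Real.abs_sin_le_one t)).trans ?_
      exact Finset.single_le_sum (f := fun p => ‖x (.inr p)‖) (fun _ _ => norm_nonneg _)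
        (Finset.mem_univ p)
  · exact ((hf.differentiable (by norm_num) _).hasFDerivAt).comp_hasDerivAt t (hasDerivAt_interp t x)

theorem IsWishartModel.abs_integral_sub_le [Nonempty τ] (H : IsWishartModel ν r σ)
    (hσ : 0 < σ) (hr : ∀ k, r k k = 1) (hs : ∀ k l, r k l = r l k)
    (hD : Fintype.card τ * σ = ∑ k, ∑ l, r k l ^ 2) {b : ℝ}
    (hT : ∑ k, ∑ l, ∑ m, ∑ o, r k l * r l m * r m o * r o k ≤ Fintype.card τ * b)
    (hf : ContDiff ℝ 2 f) (hfl : ∀ x y, |f x - f y| ≤ Real.sqrt (∑ p, (x p - y p) ^ 2))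
    (hL : ∀ x, ‖fderiv ℝ (fderiv ℝ f) x‖ ≤ L) :
    |∫ x, f (wishart x) ∂ν - ∫ x, f (fun p => x (.inr p)) ∂ν| ≤
      Real.sqrt (4 * Fintype.card ι ^ 3 * b / (Fintype.card τ * σ)) * (Real.pi / 2) := by
  have := H.isGaussian
  have h := Convex.norm_image_sub_le_of_norm_hasDerivWithin_le (s := Set.univ)
    (fun θ _ => (hasDerivAt_integral_comp_interp (ν := ν) (hf.of_le (by norm_num)) hfl
      θ).hasDerivWithinAt)
    (fun θ _ => H.abs_integral_fderiv_interp_le hσ hr hs hD hT hf hfl hL θ)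
    convex_univ (Set.mem_univ 0) (Set.mem_univ (Real.pi / 2))
  have h0 : ∀ x : (ι × τ) ⊕ (ι × ι) → ℝ, interp 0 x = fun p => x (.inr p) := fun x => by
    ext p; simp [interp]
  have h1 : ∀ x : (ι × τ) ⊕ (ι × ι) → ℝ, interp (Real.pi / 2) x = wishart x := fun x => by
    ext p; simp [interp]
  simp only [h0, h1, sub_zero, Real.norm_eq_abs, abs_of_pos Real.pi_div_two_pos] at h
  exact h

end

end Interpolation

section Transfer

theorem IsCenteredGaussianFamily.aemeasurable {Ω : Type*} [MeasureSpace Ω] {ι : Type*}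
    {X : ι → Ω → ℝ} (hX : IsCenteredGaussianFamily X) (i : ι) : AEMeasurable (X i) volume := by
  obtain ⟨v, hv⟩ := hX {i} 1
  simp only [Finset.sum_singleton, Pi.one_apply, one_mul] at hv
  exact AEMeasurable.of_map_ne_zero (hv ▸ IsProbabilityMeasure.ne_zero _)

theorem IsCenteredGaussianFamily.integral_eq_zero {Ω : Type*} [MeasureSpace Ω] {ι : Type*}
    {X : ι → Ω → ℝ} (hX : IsCenteredGaussianFamily X) (i : ι) : ∫ ω, X i ω = 0 := by
  obtain ⟨v, hv⟩ := hX {i} 1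
  simp only [Finset.sum_singleton, Pi.one_apply, one_mul] at hv
  have h := integral_map (hX.aemeasurable i) (f := fun x => x) (by fun_prop)
  rw [← h, show Measure.map (X i) volume = gaussianReal 0 v from hv, integral_id_gaussianReal]

theorem IsCenteredGaussianFamily.hasGaussianLaw {Ω : Type*} [MeasureSpace Ω] {ι : Type*} [Fintype ι]
    {X : ι → Ω → ℝ} (hX : IsCenteredGaussianFamily X) :
    HasGaussianLaw (fun ω i => X i ω) volume := by
  classical
  refine ⟨isGaussian_of_map_eq_gaussianReal fun L => ?_⟩
  obtain ⟨v, hv⟩ := hX Finset.univ fun i => L (Pi.single i 1)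
  refine ⟨0, v, ?_⟩
  rw [← hv, AEMeasurable.map_map_of_aemeasurable (by fun_prop)
    (aemeasurable_pi_lambda _ fun i => hX.aemeasurable i)]
  congr 1
  ext ω
  exact fderiv_eq_sum_single L _

section SumElim

variable {α β : Type*}

/-- Concatenation of two vectors, as a continuous linear map. -/
def sumElimCLM (α β : Type*) : (α → ℝ) × (β → ℝ) →L[ℝ] (α ⊕ β → ℝ) :=
  ContinuousLinearMap.pi (Sum.elim
    (fun a => (ContinuousLinearMap.proj a).comp (ContinuousLinearMap.fst ℝ (α → ℝ) (β → ℝ)))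
    (fun b => (ContinuousLinearMap.proj b).comp (ContinuousLinearMap.snd ℝ (α → ℝ) (β → ℝ))))

theorem sumElimCLM_inl (z : (α → ℝ) × (β → ℝ)) (a : α) : sumElimCLM α β z (.inl a) = z.1 a := rfl

theorem sumElimCLM_inr (z : (α → ℝ) × (β → ℝ)) (b : β) : sumElimCLM α β z (.inr b) = z.2 b := rfl

variable [Fintype α] [Fintype β] {ν₁ : Measure (α → ℝ)} {ν₂ : Measure (β → ℝ)} [IsProbabilityMeasure ν₁]
  [IsProbabilityMeasure ν₂]

theorem integral_map_sumElimCLM_inl {F : (α → ℝ) → ℝ} (hF : Continuous F) :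
    ∫ x, F (fun a => x (.inl a)) ∂(ν₁.prod ν₂).map (sumElimCLM α β) = ∫ y, F y ∂ν₁ := by
  rw [integral_map (by fun_prop)
    (Continuous.aestronglyMeasurable (hF.comp' (continuous_pi fun _ => continuous_apply _)))]
  simp only [sumElimCLM_inl]
  simpa using integral_fun_fst (μ := ν₁) (ν := ν₂) F

theorem integral_map_sumElimCLM_inr {F : (β → ℝ) → ℝ} (hF : Continuous F) :
    ∫ x, F (fun b => x (.inr b)) ∂(ν₁.prod ν₂).map (sumElimCLM α β) = ∫ y, F y ∂ν₂ := by
  rw [integral_map (by fun_prop)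
    (Continuous.aestronglyMeasurable (hF.comp' (continuous_pi fun _ => continuous_apply _)))]
  simp only [sumElimCLM_inr]
  simpa using integral_fun_snd (μ := ν₁) (ν := ν₂) F

theorem integral_map_sumElimCLM_mul (a : α) (b : β) :
    ∫ x, x (.inl a) * x (.inr b) ∂(ν₁.prod ν₂).map (sumElimCLM α β) =
      (∫ y, y a ∂ν₁) * ∫ y, y b ∂ν₂ := by
  rw [integral_map (by fun_prop) (by fun_prop)]
  simp only [sumElimCLM_inl, sumElimCLM_inr]
  exact integral_prod_mul (fun y : α → ℝ => y a) fun y : β → ℝ => y b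

end SumElim

/-- The vector formed by a Gaussian matrix and an independent copy of another one. -/
theorem exists_isWishartModel {Ω : Type*} [MeasureSpace Ω] {ι τ : Type*} [Fintype ι] [Fintype τ]
    [DecidableEq ι] {X : ι × τ → Ω → ℝ} {G : ι × ι → Ω → ℝ} (hX : IsCenteredGaussianFamily X)
    (hG : IsCenteredGaussianFamily G) {r : τ → τ → ℝ} {σ : ℝ}
    (hXX : ∀ i k j l, ∫ ω, X (i, k) ω * X (j, l) ω = (if i = j then 1 else 0) * r k l)
    (hGG : ∀ i v q, ∫ ω, G (i, v) ω * G q ω = symmSingle i v q * σ) :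
    ∃ ν : Measure ((ι × τ) ⊕ (ι × ι) → ℝ), IsWishartModel ν r σ ∧
      (∀ F : (ι × τ → ℝ) → ℝ, Continuous F →
        ∫ x, F (fun a => x (.inl a)) ∂ν = ∫ ω, F (fun a => X a ω)) ∧
      ∀ F : (ι × ι → ℝ) → ℝ, Continuous F →
        ∫ x, F (fun b => x (.inr b)) ∂ν = ∫ ω, F (fun b => G b ω) := by
  have hXl := hX.hasGaussianLaw
  have hGl := hG.hasGaussianLaw
  have := hXl.isGaussian_map
  have := hGl.isGaussian_map
  have hl : ∀ F : (ι × τ → ℝ) → ℝ, Continuous F → ∫ x, F (fun a => x (.inl a))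
      ∂((volume.map fun ω a => X a ω).prod (volume.map fun ω b => G b ω)).map
        (sumElimCLM (ι × τ) (ι × ι)) = ∫ ω, F (fun a => X a ω) := fun F hF => by
    rw [integral_map_sumElimCLM_inl hF, integral_map hXl.aemeasurable hF.aestronglyMeasurable]
  have hr : ∀ F : (ι × ι → ℝ) → ℝ, Continuous F → ∫ x, F (fun b => x (.inr b))
      ∂((volume.map fun ω a => X a ω).prod (volume.map fun ω b => G b ω)).map
        (sumElimCLM (ι × τ) (ι × ι)) = ∫ ω, F (fun b => G b ω) := fun F hF => by
    rw [integral_map_sumElimCLM_inr hF, integral_map hGl.aemeasurable hF.aestronglyMeasurable]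
  refine ⟨_, ⟨isGaussian_map _, ?_, fun i k j l => ?_, fun a b => ?_, fun i v q => ?_⟩, hl, hr⟩
  · rintro (a | b)
    · rw [hl (fun y => y a) (continuous_apply a), hX.integral_eq_zero]
    · rw [hr (fun y => y b) (continuous_apply b), hG.integral_eq_zero]
  · rw [hl (fun y => y (i, k) * y (j, l)) (by fun_prop), hXX]
  · rw [integral_map_sumElimCLM_mul, integral_map hXl.aemeasurable
      (f := fun y : ι × τ → ℝ => y a) (continuous_apply a).aestronglyMeasurable,
      hX.integral_eq_zero, zero_mul]
  · rw [hr (fun y => y (i, v) * y q) (by fun_prop), hGG]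

end Transfer

section Lipschitz

variable {ι τ κ : Type*} [Fintype ι] [DecidableEq ι] [Fintype τ] [Fintype κ] {r : τ → τ → ℝ}
  {σ : ℝ} {ν : Measure ((ι × τ) ⊕ (ι × ι) → ℝ)} {g : (ι × ι → ℝ) → ℝ}

theorem HasPolynomialGrowth.comp_lipschitz {E : Type*} [NormedAddCommGroup E] {u : E → κ → ℝ}
    (hu : HasPolynomialGrowth u) {f : (κ → ℝ) → ℝ}
    (hf : ∀ x y, |f x - f y| ≤ Real.sqrt (∑ i, (x i - y i) ^ 2)) :
    HasPolynomialGrowth fun x => f (u x) := by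
  have hl := lipschitzWith_of_abs_sub_le_euclidean hf
  refine hu.of_le (hl.continuous.comp hu.1) (norm_nonneg (f 0))
    (NNReal.coe_nonneg (NNReal.sqrt (Fintype.card κ))) fun x => ?_
  have h := hl.dist_le_mul (u x) 0
  rw [dist_eq_norm, dist_zero_right] at h
  linarith [norm_le_norm_add_norm_sub' (f (u x)) (f 0)]

theorem abs_integral_comp_sub_le {E : Type*} [NormedAddCommGroup E] [NormedSpace ℝ E]
    [MeasurableSpace E] [BorelSpace E] [CompleteSpace E] [SecondCountableTopology E] {μ : Measure E}
    [IsGaussian μ] {u : E → κ → ℝ} (hu : HasPolynomialGrowth u) {f g : (κ → ℝ) → ℝ}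
    (hf : ∀ x y, |f x - f y| ≤ Real.sqrt (∑ i, (x i - y i) ^ 2))
    (hg : ∀ x y, |g x - g y| ≤ Real.sqrt (∑ i, (x i - y i) ^ 2)) {ε : ℝ}
    (hfg : ∀ x, |f x - g x| ≤ ε) : |∫ x, f (u x) ∂μ - ∫ x, g (u x) ∂μ| ≤ ε := by
  rw [← integral_sub (hu.comp_lipschitz hf).integrable (hu.comp_lipschitz hg).integrable]
  simpa using norm_integral_le_of_norm_le_const (μ := μ) (f := fun x => f (u x) - g (u x))
    (ae_of_all _ fun x => hfg (u x))

theorem IsWishartModel.abs_integral_sub_le_of_lipschitz [Nonempty τ] (H : IsWishartModel ν r σ)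
    (hσ : 0 < σ) (hr : ∀ k, r k k = 1) (hs : ∀ k l, r k l = r l k)
    (hD : Fintype.card τ * σ = ∑ k, ∑ l, r k l ^ 2) {b : ℝ}
    (hT : ∑ k, ∑ l, ∑ m, ∑ o, r k l * r l m * r m o * r o k ≤ Fintype.card τ * b)
    (hg : ∀ x y, |g x - g y| ≤ Real.sqrt (∑ p, (x p - y p) ^ 2)) :
    |∫ x, g (wishart x) ∂ν - ∫ x, g (fun p => x (.inr p)) ∂ν| ≤
      Real.sqrt (4 * Fintype.card ι ^ 3 * b / (Fintype.card τ * σ)) * (Real.pi / 2) := by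
  have := H.isGaussian
  refine le_of_forall_pos_le_add fun ε hε => ?_
  obtain ⟨f, hf, hfl, hfg, L, hL⟩ := exists_contDiff_approx hg (half_pos hε)
  have h := abs_le.1 (H.abs_integral_sub_le hσ hr hs hD hT hf hfl hL)
  have h1 := abs_le.1 (abs_integral_comp_sub_le (μ := ν)
    (HasPolynomialGrowth.pi hasPolynomialGrowth_wishart) hfl hg hfg)
  have h2 := abs_le.1 (abs_integral_comp_sub_le (μ := ν) (u := fun x p => x (.inr p))
    (HasPolynomialGrowth.pi fun _ => .eval _) hfl hg hfg)
  exact abs_le.2 ⟨by linarith, by linarith⟩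

end Lipschitz

/-- **Theorem 1.1, bound (1.7)**: Wasserstein bound between the normalized correlated Wishart
matrix `W` and the Gaussian matrix `G` with the same covariance structure. -/
theorem wishart_gaussian_approximation
    {Ω : Type*} [MeasureSpace Ω] [IsProbabilityMeasure (volume : Measure Ω)]
    (n d : ℕ) (hn : 1 ≤ n) (hd : 1 ≤ d)
    (s : ℤ → ℝ) (hs_even : ∀ k, s (-k) = s k) (hs0 : s 0 = 1)
    (X : Fin n → Fin d → Ω → ℝ)
    (hX_gauss : IsCenteredGaussianFamily (fun p : Fin n × Fin d => X p.1 p.2))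
    (hX_cov : ∀ (i i' : Fin n) (j j' : Fin d),
      ∫ ω, X i j ω * X i' j' ω = (if i = i' then 1 else 0) * s ((j : ℤ) - (j' : ℤ)))
    (W : Ω → Matrix (Fin n) (Fin n) ℝ)
    (hW : ∀ ω i j, W ω i j =
      (1 / Real.sqrt d) * ((∑ k : Fin d, X i k ω * X j k ω) - if i = j then (d : ℝ) else 0))
    (G : Ω → Matrix (Fin n) (Fin n) ℝ)
    (hG_symm : ∀ ω i j, G ω i j = G ω j i)
    (hG_gauss : IsCenteredGaussianFamily (fun p : Fin n × Fin n => fun ω => G ω p.1 p.2))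
    (hG_cov : ∀ i j u v : Fin n,
      ∫ ω, G ω i j * G ω u v =
        ((if i = u then 1 else 0) * (if j = v then 1 else 0)
          + (if i = v then 1 else 0) * (if j = u then 1 else 0))
          * ((1 / (d : ℝ)) * ∑ k ∈ Finset.Icc 1 (d : ℤ), ∑ l ∈ Finset.Icc 1 (d : ℤ), s (k - l) ^ 2))
    (g : Matrix (Fin n) (Fin n) ℝ → ℝ)
    (hg : ∀ A B : Matrix (Fin n) (Fin n) ℝ,
      |g A - g B| ≤ Real.sqrt (∑ i : Fin n, ∑ j : Fin n, (A i j - B i j) ^ 2)) :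
    (∫ ω, g (W ω)) - (∫ ω, g (G ω)) ≤
      Real.sqrt (192 * (n : ℝ) ^ 3 * (∑ k ∈ Finset.Icc (-(d : ℤ)) (d : ℤ), |s k| ^ ((4 : ℝ) / 3)) ^ 3
        / ((d : ℝ) * ∑ k ∈ Finset.Icc (-(d : ℤ)) (d : ℤ), (1 - |(k : ℝ)| / d) * s k ^ 2)) := by
  have : Nonempty (Fin d) := ⟨⟨0, hd⟩⟩
  obtain ⟨r, hr⟩ : ∃ r : Fin d → Fin d → ℝ, ∀ k l, r k l = s ((k : ℤ) - l) := ⟨_, fun _ _ => rfl⟩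
  obtain ⟨σ, hσ⟩ : ∃ σ : ℝ, (1 / (d : ℝ)) *
    ∑ k ∈ Finset.Icc 1 (d : ℤ), ∑ l ∈ Finset.Icc 1 (d : ℤ), s (k - l) ^ 2 = σ := ⟨_, rfl⟩
  simp only [hσ] at hG_cov
  have hd0 : (0 : ℝ) < d := by positivity
  have hrr : ∀ k, r k k = 1 := fun k => by rw [hr, sub_self, hs0]
  have hD : d * σ = ∑ k, ∑ l, r k l ^ 2 := by
    rw [← hσ, sum_Icc_one_eq_sum_fin d (fun k l => s (k - l) ^ 2) fun k l => by ring_nf,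
      ← mul_assoc, mul_one_div_cancel hd0.ne', one_mul]
    simp only [hr]
  have hσ0 : 0 < σ := by
    refine pos_of_mul_pos_right (a := (d : ℝ)) ?_ hd0.le
    rw [hD]
    refine Finset.sum_pos (fun k _ => ?_) Finset.univ_nonempty
    exact Finset.sum_pos' (fun l _ => sq_nonneg _) ⟨k, Finset.mem_univ k, by simp [hrr]⟩
  obtain ⟨ν, H, hνX, hνG⟩ := exists_isWishartModel (r := r) (σ := σ) hX_gauss hG_gauss
    (fun i k j l => by rw [hX_cov, hr]) fun i v q => by rw [hG_cov, symmSingle]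
  let h : (Fin n × Fin n → ℝ) → ℝ := fun y => g (Matrix.of fun i j => y (i, j))
  have hh : ∀ x y, |h x - h y| ≤ Real.sqrt (∑ p, (x p - y p) ^ 2) := fun x y => by
    rw [Fintype.sum_prod_type]
    exact hg _ _
  have hhc := (lipschitzWith_of_abs_sub_le_euclidean hh).continuous
  have hT : ∑ k, ∑ l, ∑ m, ∑ o, r k l * r l m * r m o * r o k ≤ Fintype.card (Fin d) *
      (∑ m ∈ Finset.Icc (-(d : ℤ)) d, |s m| ^ (4 / 3 : ℝ)) ^ 3 := by
    simpa only [hr, Fintype.card_fin] using sum_cycle_le (d := d) s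
  have key := H.abs_integral_sub_le_of_lipschitz hσ0 hrr
    (fun k l => by rw [hr, hr, ← hs_even, neg_sub]) (by rwa [Fintype.card_fin]) hT hh
  have hWint : ∫ x, h (wishart x) ∂ν = ∫ ω, g (W ω) := by
    have hW' : ∀ ω, W ω = Matrix.of fun i j => 1 / Real.sqrt d *
        (∑ k, X i k ω * X j k ω - if i = j then (d : ℝ) else 0) := fun ω => by
      ext i j
      exact hW ω i j
    have hw : Continuous fun (y : Fin n × Fin d → ℝ) (p : Fin n × Fin n) => 1 / Real.sqrt d *
        (∑ k, y (p.1, k) * y (p.2, k) - if p.1 = p.2 then (d : ℝ) else 0) := by fun_prop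
    have hX := hνX _ (hhc.comp hw)
    simp only [h, Function.comp_apply, wishart, Fintype.card_fin, hW'] at hX ⊢
    exact hX
  have hGint : ∫ x, h (fun p => x (.inr p)) ∂ν = ∫ ω, g (G ω) := hνG h hhc
  rw [hWint, hGint, Fintype.card_fin, Fintype.card_fin, hD] at key
  rw [mul_sum_one_sub_abs_div s hd]
  simp only [← hr]
  refine (le_abs_self _).trans (key.trans ?_)
  obtain ⟨A, hA⟩ : ∃ A, 4 * (n : ℝ) ^ 3 *
    (∑ m ∈ Finset.Icc (-(d : ℤ)) d, |s m| ^ ((4 : ℝ) / 3)) ^ 3 / ∑ k, ∑ l, r k l ^ 2 = A := ⟨_, rfl⟩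
  have hA0 : 0 ≤ A := by rw [← hA]; positivity
  rw [hA]
  refine Real.le_sqrt_of_sq_le ?_
  calc (Real.sqrt A * (Real.pi / 2)) ^ 2 = A * (Real.pi / 2) ^ 2 := by
        rw [mul_pow, Real.sq_sqrt hA0]
    _ ≤ A * 48 := mul_le_mul_of_nonneg_left (by nlinarith [Real.pi_pos, Real.pi_le_four]) hA0
    _ = _ := by rw [← hA]; ring
end

section
/- For every function s : ℤ → ℝ and every integer d ≥ 1, one has Σ_{k,ℓ,u,v=1}^{d} |s(k−ℓ)·s(ℓ−u)·s(u−v)·s(v−k)| ≤ d · ( Σ_{|j|≤d} |s(j)|^{4/3} )³. -/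
/-- Relabelling the four summation variables cyclically does not change a fourfold sum. -/
theorem Finset.sum_four_rotate {ι : Type*} (I : Finset ι) (F : ι → ι → ι → ι → ℝ) :
    ∑ k ∈ I, ∑ l ∈ I, ∑ u ∈ I, ∑ v ∈ I, F l u v k =
      ∑ k ∈ I, ∑ l ∈ I, ∑ u ∈ I, ∑ v ∈ I, F k l u v := by
  rw [Finset.sum_comm]
  refine Finset.sum_congr rfl fun l _ => ?_
  rw [Finset.sum_comm]
  refine Finset.sum_congr rfl fun u _ => ?_
  rw [Finset.sum_comm]

/-- A fourfold sum over a path of three differences is bounded by summing out the variables one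
at a time. -/
theorem sum_path_three_le (b : ℤ → ℝ) (hb : ∀ j, 0 ≤ b j) (d : ℕ) :
    ∑ k ∈ Finset.Icc 1 (d : ℤ), ∑ l ∈ Finset.Icc 1 (d : ℤ),
      ∑ u ∈ Finset.Icc 1 (d : ℤ), ∑ v ∈ Finset.Icc 1 (d : ℤ),
        b (k - l) * b (l - u) * b (u - v) ≤
      (d : ℝ) * (∑ j ∈ Finset.Icc (-(d : ℤ)) (d : ℤ), b j) ^ 3 := by
  set B := ∑ j ∈ Finset.Icc (-(d : ℤ)) (d : ℤ), b j with hB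
  have hB0 : 0 ≤ B := Finset.sum_nonneg fun j _ => hb j
  have row : ∀ x ∈ Finset.Icc 1 (d : ℤ), ∑ y ∈ Finset.Icc 1 (d : ℤ), b (x - y) ≤ B := by
    intro x hx
    rw [← Finset.sum_image (s := Finset.Icc 1 (d : ℤ)) (g := fun y => x - y) (f := b)
      fun y _ z _ h => by simpa using h]
    refine Finset.sum_le_sum_of_subset_of_nonneg ?_ fun j _ _ => hb j
    intro j hj
    simp only [Finset.mem_image, Finset.mem_Icc] at hj hx ⊢
    obtain ⟨y, hy, rfl⟩ := hj
    omega
  have step : ∀ x ∈ Finset.Icc 1 (d : ℤ), ∀ c : ℝ, 0 ≤ c → ∀ f : ℤ → ℝ,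
      (∀ y ∈ Finset.Icc 1 (d : ℤ), f y ≤ b (x - y) * c) →
      ∑ y ∈ Finset.Icc 1 (d : ℤ), f y ≤ B * c := by
    intro x hx c hc f hf
    refine (Finset.sum_le_sum hf).trans ?_
    rw [← Finset.sum_mul]
    exact mul_le_mul_of_nonneg_right (row x hx) hc
  have hk : ∀ k ∈ Finset.Icc 1 (d : ℤ), ∑ l ∈ Finset.Icc 1 (d : ℤ),
      ∑ u ∈ Finset.Icc 1 (d : ℤ), ∑ v ∈ Finset.Icc 1 (d : ℤ),
        b (k - l) * b (l - u) * b (u - v) ≤ B * (B * B) := by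
    intro k hk
    refine step k hk _ (by positivity) _ fun l hl => ?_
    simp only [mul_assoc, ← Finset.mul_sum]
    refine mul_le_mul_of_nonneg_left (step l hl _ hB0 _ fun u hu => ?_) (hb _)
    exact mul_le_mul_of_nonneg_left (row u hu) (hb _)
  refine (Finset.sum_le_sum hk).trans (le_of_eq ?_)
  simp only [Finset.sum_const, Int.card_Icc, nsmul_eq_mul, add_sub_cancel_right, Int.toNat_natCast]
  ring

/-- The arithmetic-geometric mean inequality for the four triple products of the numbers
`wᵢ ^ (4 / 3)`. -/
theorem mul_four_le_triple_products {w x y z : ℝ}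
    (hw : 0 ≤ w) (hx : 0 ≤ x) (hy : 0 ≤ y) (hz : 0 ≤ z) :
    w * x * y * z ≤
      (w ^ ((4 : ℝ) / 3) * x ^ ((4 : ℝ) / 3) * y ^ ((4 : ℝ) / 3) +
        x ^ ((4 : ℝ) / 3) * y ^ ((4 : ℝ) / 3) * z ^ ((4 : ℝ) / 3) +
        y ^ ((4 : ℝ) / 3) * z ^ ((4 : ℝ) / 3) * w ^ ((4 : ℝ) / 3) +
        z ^ ((4 : ℝ) / 3) * w ^ ((4 : ℝ) / 3) * x ^ ((4 : ℝ) / 3)) / 4 := by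
  have root : ∀ t : ℝ, 0 ≤ t → ∃ c : ℝ, t = c ^ 3 ∧ t ^ ((4 : ℝ) / 3) = c ^ 4 := by
    intro t ht
    refine ⟨t ^ ((1 : ℝ) / 3), ?_, ?_⟩ <;> rw [← Real.rpow_natCast, ← Real.rpow_mul ht] <;>
      norm_num
  obtain ⟨p, hp, hp'⟩ := root w hw
  obtain ⟨q, hq, hq'⟩ := root x hx
  obtain ⟨r, hr, hr'⟩ := root y hy
  obtain ⟨t, ht, ht'⟩ := root z hz
  rw [hp', hq', hr', ht', hp, hq, hr, ht]
  have amgm : ∀ a b c e : ℝ, a * b * c * e ≤ (a ^ 4 + b ^ 4 + c ^ 4 + e ^ 4) / 4 := by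
    intro a b c e
    nlinarith [sq_nonneg (a ^ 2 - b ^ 2), sq_nonneg (c ^ 2 - e ^ 2), sq_nonneg (a * b - c * e)]
  calc p ^ 3 * q ^ 3 * r ^ 3 * t ^ 3
      = (p * q * r) * (q * r * t) * (r * t * p) * (t * p * q) := by ring
    _ ≤ _ := amgm _ _ _ _
    _ = _ := by ring

/-- **Fact 3 (Section 2.1)**: the Hölder/Young-type estimate
`∑_{k,ℓ,u,v=1}^{d} |s(k−ℓ)s(ℓ−u)s(u−v)s(v−k)| ≤ d · (∑_{|j|≤d} |s(j)|^{4/3})³`. -/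
theorem cyclic_fourfold_sum_le
    (s : ℤ → ℝ) (d : ℕ) (hd : 1 ≤ d) :
    ∑ k ∈ Finset.Icc 1 (d : ℤ), ∑ l ∈ Finset.Icc 1 (d : ℤ),
      ∑ u ∈ Finset.Icc 1 (d : ℤ), ∑ v ∈ Finset.Icc 1 (d : ℤ),
        |s (k - l) * s (l - u) * s (u - v) * s (v - k)| ≤
      (d : ℝ) * (∑ j ∈ Finset.Icc (-(d : ℤ)) (d : ℤ), |s j| ^ ((4 : ℝ) / 3)) ^ 3 := by
  set b : ℤ → ℝ := fun j => |s j| ^ ((4 : ℝ) / 3) with hb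
  set I := Finset.Icc 1 (d : ℤ) with hI
  have path := sum_path_three_le b (fun j => by positivity) d
  rw [← hI] at path
  let F : ℤ → ℤ → ℤ → ℤ → ℝ := fun k l u v => b (k - l) * b (l - u) * b (u - v)
  have h1 := Finset.sum_four_rotate I F
  have h2 := Finset.sum_four_rotate I fun k l u v => F l u v k
  have h3 := Finset.sum_four_rotate I fun k l u v => F u v k l
  have pointwise : ∀ k l u v : ℤ, |s (k - l) * s (l - u) * s (u - v) * s (v - k)| ≤
      (F k l u v + F l u v k + F u v k l + F v k l u) / 4 := by
    intro k l u v
    simp only [abs_mul]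
    exact mul_four_le_triple_products (abs_nonneg _) (abs_nonneg _) (abs_nonneg _) (abs_nonneg _)
  calc _ ≤ ∑ k ∈ I, ∑ l ∈ I, ∑ u ∈ I, ∑ v ∈ I,
        (F k l u v + F l u v k + F u v k l + F v k l u) / 4 := by
        gcongr
        exact pointwise _ _ _ _
    _ = ∑ k ∈ I, ∑ l ∈ I, ∑ u ∈ I, ∑ v ∈ I, F k l u v := by
        simp only [← Finset.sum_div, Finset.sum_add_distrib]
        linarith
    _ ≤ _ := path
end

section
/- For H = 3/4, define s_H : ℤ → ℝ by s_H(k) = ½( |k+1|^{2H} + |k−1|^{2H} − 2|k|^{2H} ). Then there exists a constant c > 0 such that (1/log d) · Σ_{|k|≤d} (1 − |k|/d) s_{3/4}(k)² → c as d → ∞. -/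
open Filter

open Asymptotics Topology

/-- The symmetric second difference quotient at `1` of a real power. -/
lemma tendsto_rpow_second_difference_quotient (p : ℝ) :
    Tendsto (fun h : ℝ => ((1 + h) ^ p + (1 - h) ^ p - 2) / h ^ 2) (𝓝[≠] 0)
      (𝓝 (p * (p - 1))) := by
  have hder_add (q x : ℝ) (hx : -1 < x) :
      HasDerivAt (fun h : ℝ => (1 + h) ^ q) (q * (1 + x) ^ (q - 1)) x := by
    simpa using ((hasDerivAt_id x).const_add 1).rpow_const (p := q)
      (Or.inl (by simp only [id]; linarith : (1 : ℝ) + id x ≠ 0))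
  have hder_sub (q x : ℝ) (hx : x < 1) :
      HasDerivAt (fun h : ℝ => (1 - h) ^ q) (-(q * (1 - x) ^ (q - 1))) x := by
    simpa using ((hasDerivAt_id x).const_sub 1).rpow_const (p := q)
      (Or.inl (by simp only [id]; linarith : (1 : ℝ) - id x ≠ 0))
  have hnear : ∀ᶠ x : ℝ in 𝓝[≠] 0, -1 < x ∧ x < 1 :=
    nhdsWithin_le_nhds (Ioo_mem_nhds (by norm_num) (by norm_num))
  have hslope : Tendsto (fun h : ℝ => ((1 + h) ^ (p - 1) - (1 - h) ^ (p - 1)) / h)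
      (𝓝[≠] 0) (𝓝 (2 * (p - 1))) := by
    have h := ((hder_add (p - 1) 0 (by norm_num)).sub
      (hder_sub (p - 1) 0 (by norm_num))).tendsto_slope
    refine (h.congr fun x => ?_).trans_eq ?_
    · simp [slope_def_field]
    · simp; ring_nf
  refine HasDerivAt.lhopital_zero_nhdsNE
    (f' := fun x => p * (1 + x) ^ (p - 1) + -(p * (1 - x) ^ (p - 1))) (g' := fun x => 2 * x)
    ?_ ?_ ?_ ?_ ?_ ?_
  · filter_upwards [hnear] with x hx
    exact ((hder_add p x hx.1).add (hder_sub p x hx.2)).sub_const 2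
  · exact Eventually.of_forall fun x => by simpa using hasDerivAt_pow 2 x
  · filter_upwards [self_mem_nhdsWithin] with x hx
    exact mul_ne_zero two_ne_zero hx
  · have h := (((hder_add p 0 (by norm_num)).add
      (hder_sub p 0 (by norm_num))).sub_const 2).continuousAt.tendsto
    refine (h.mono_left nhdsWithin_le_nhds).trans_eq ?_
    norm_num
  · have h : Tendsto (fun x : ℝ => x ^ 2) (𝓝 0) (𝓝 (0 ^ 2)) := (continuous_pow 2).tendsto 0
    simpa using h.mono_left nhdsWithin_le_nhds
  · convert hslope.const_mul (p / 2) using 2 with x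
    · rcases eq_or_ne x 0 with rfl | hx
      · simp
      · field_simp; ring
    · ring

lemma tendsto_harmonic_div_log :
    Tendsto (fun n : ℕ => (harmonic n : ℝ) / Real.log n) atTop (𝓝 1) := by
  have hlog : Tendsto (fun n : ℕ => Real.log n) atTop atTop :=
    Real.tendsto_log_atTop.comp tendsto_natCast_atTop_atTop
  have h := (Real.tendsto_harmonic_sub_log.div_atTop hlog).add_const 1
  rw [zero_add] at h
  refine h.congr' ?_
  filter_upwards [hlog.eventually_gt_atTop 0] with n hn
  field_simp
  ring

lemma tendsto_sum_range_div_log {f : ℕ → ℝ} {L : ℝ}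
    (hf : Tendsto (fun n : ℕ => ((n : ℝ) + 1) * f n) atTop (𝓝 L)) :
    Tendsto (fun n : ℕ => (∑ k ∈ Finset.range n, f k) / Real.log n) atTop (𝓝 L) := by
  have hharm (n : ℕ) : ∑ k ∈ Finset.range n, ((k : ℝ) + 1)⁻¹ = harmonic n := by
    simp [harmonic]
  have hlog : Tendsto (fun n : ℕ => Real.log n) atTop atTop :=
    Real.tendsto_log_atTop.comp tendsto_natCast_atTop_atTop
  have hatTop : Tendsto (fun n : ℕ => ∑ k ∈ Finset.range n, ((k : ℝ) + 1)⁻¹) atTop atTop := by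
    refine tendsto_atTop_mono (fun n => ?_) (hlog.comp (tendsto_add_atTop_nat 1))
    rw [hharm]
    exact log_add_one_le_harmonic n
  have hsmall : (fun n : ℕ => f n - L * ((n : ℝ) + 1)⁻¹) =o[atTop]
      fun n : ℕ => ((n : ℝ) + 1)⁻¹ := by
    rw [isLittleO_iff_tendsto' (Eventually.of_forall fun n hn =>
      absurd hn (by positivity))]
    refine (tendsto_sub_nhds_zero_iff.2 hf).congr fun n => ?_
    have : (n : ℝ) + 1 ≠ 0 := by positivity
    field_simp
  have hsum := (hsmall.sum_range (fun n => by simp only [Pi.zero_apply]; positivity)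
    hatTop).tendsto_div_nhds_zero
  have h := (hsum.add_const L).mul tendsto_harmonic_div_log
  rw [zero_add, mul_one] at h
  refine h.congr' ?_
  filter_upwards [hatTop.eventually_gt_atTop 0] with n hn
  rw [Finset.sum_sub_distrib, ← Finset.mul_sum]
  rw [hharm] at hn ⊢
  field_simp
  ring

lemma tendsto_fejer_sum_div_log {f : ℤ → ℝ} {L : ℝ} (heven : ∀ k, f (-k) = f k)
    (hf : Tendsto (fun n : ℕ => ((n : ℝ) + 1) * f (n + 1)) atTop (𝓝 L)) :
    Tendsto (fun d : ℕ =>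
        (∑ k ∈ Finset.Icc (-(d : ℤ)) (d : ℤ), (1 - |(k : ℝ)| / d) * f k) / Real.log d)
      atTop (𝓝 (2 * L)) := by
  have hlog : Tendsto (fun n : ℕ => Real.log n) atTop atTop :=
    Real.tendsto_log_atTop.comp tendsto_natCast_atTop_atTop
  have h := (((tendsto_sum_range_div_log hf).sub (hf.cesaro.div_atTop hlog)).const_mul 2).add
    (tendsto_const_nhds (x := f 0).div_atTop hlog)
  rw [sub_zero, add_zero] at h
  refine h.congr fun d => ?_
  have hsym := Finset.sum_Icc_of_even_eq_range
    (f := fun k : ℤ => (1 - |(k : ℝ)| / d) * f k) (fun k => by simp [heven]) d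
  rw [hsym, Finset.sum_range_succ']
  have habs (k : ℕ) : |(k : ℝ) + 1| = k + 1 := abs_of_pos (by positivity)
  have hsplit : ∑ k ∈ Finset.range d, (1 - ((k : ℝ) + 1) / d) * f (k + 1) =
      ∑ k ∈ Finset.range d, f (k + 1) -
        (d : ℝ)⁻¹ * ∑ k ∈ Finset.range d, ((k : ℝ) + 1) * f (k + 1) := by
    rw [Finset.mul_sum, ← Finset.sum_sub_distrib]
    exact Finset.sum_congr rfl fun k _ => by ring
  simp only [Nat.cast_add, Nat.cast_one, Int.cast_add, Int.cast_natCast, Int.cast_one, habs,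
    hsplit, Nat.cast_zero, Int.cast_zero, abs_zero]
  simp only [nsmul_eq_mul]
  push_cast
  ring

/-- **Section 1**: for `H = 3/4`, the normalizing variance
`∑_{|k|≤d} (1 − |k|/d) s_{3/4}(k)²` grows logarithmically: there is `c > 0` with
`(1/log d) · ∑_{|k|≤d} (1 − |k|/d) s_{3/4}(k)² → c`. -/
theorem fractional_noise_variance_log_asymptotics
    (H : ℝ) (hH : H = 3 / 4)
    (s : ℤ → ℝ)
    (hs : ∀ k : ℤ, s k =
      (|(k : ℝ) + 1| ^ (2 * H) + |(k : ℝ) - 1| ^ (2 * H) - 2 * |(k : ℝ)| ^ (2 * H)) / 2) :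
    ∃ c > (0 : ℝ),
      Tendsto (fun d : ℕ =>
          (∑ k ∈ Finset.Icc (-(d : ℤ)) (d : ℤ), (1 - |(k : ℝ)| / d) * s k ^ 2) / Real.log d)
        atTop (nhds c) := by
  have hp : 2 * H = 3 / 2 := by rw [hH]; norm_num
  rw [hp] at hs
  refine ⟨2 * (9 / 64), by norm_num, tendsto_fejer_sum_div_log (f := fun k => s k ^ 2)
    (fun k => ?_) ?_⟩
  · have h₁ : |-(k : ℝ) + 1| = |(k : ℝ) - 1| := by rw [← abs_neg]; ring_nf
    have h₂ : |-(k : ℝ) - 1| = |(k : ℝ) + 1| := by rw [← abs_neg]; ring_nf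
    simp only [hs, Int.cast_neg, h₁, h₂, abs_neg]
    ring
  have hinv : Tendsto (fun n : ℕ => 1 / ((n : ℝ) + 1)) atTop (𝓝[≠] 0) :=
    tendsto_nhdsWithin_iff.2 ⟨tendsto_one_div_add_atTop_nhds_zero_nat,
      Eventually.of_forall fun n => by
        simp only [Set.mem_compl_iff, Set.mem_singleton_iff]; positivity⟩
  have h := (((tendsto_rpow_second_difference_quotient (3 / 2)).comp hinv).pow 2).div_const 4
  norm_num only at h
  refine h.congr fun n => ?_
  have hx : (0 : ℝ) < n + 1 := by positivity
  have hx₁ : (1 : ℝ) ≤ n + 1 := by linarith [n.cast_nonneg (α := ℝ)]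
  simp only [hs, Function.comp_apply]
  push_cast
  generalize (n : ℝ) + 1 = x at hx hx₁
  have hinv_le : 1 / x ≤ 1 := (div_le_one hx).2 hx₁
  have hadd : (x + 1) ^ (3 / 2 : ℝ) = x ^ (3 / 2 : ℝ) * (1 + 1 / x) ^ (3 / 2 : ℝ) := by
    rw [← Real.mul_rpow hx.le (by positivity)]
    congr 1
    field_simp
  have hsub : (x - 1) ^ (3 / 2 : ℝ) = x ^ (3 / 2 : ℝ) * (1 - 1 / x) ^ (3 / 2 : ℝ) := by
    rw [← Real.mul_rpow hx.le (by linarith)]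
    congr 1
    field_simp
  have hcube : (x ^ (3 / 2 : ℝ)) ^ 2 = x ^ 3 := by
    rw [← Real.rpow_natCast, ← Real.rpow_mul hx.le]
    norm_num
  rw [abs_of_pos hx, abs_of_pos (by linarith : 0 < x + 1),
    abs_of_nonneg (by linarith : 0 ≤ x - 1), hadd, hsub]
  generalize (1 + 1 / x) ^ (3 / 2 : ℝ) = a
  generalize (1 - 1 / x) ^ (3 / 2 : ℝ) = b
  calc ((a + b - 2) / (1 / x) ^ 2) ^ 2 / 4 = x * (x ^ 3 * (a + b - 2) ^ 2 / 4) := by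
        field_simp
    _ = _ := by rw [← hcube]; ring
end

section
/- Let H ∈ (3/4, 1). Then, as d and d' both tend to infinity, (1/(dd')) Σ_{p=0}^{d−1} Σ_{q=0}^{d'−1} ( d·d' · ∫_{p/d}^{(p+1)/d} ∫_{q/d'}^{(q+1)/d'} |u−v|^{2H−2} dv du )² → ∫_0^1 ∫_0^1 |u−v|^{4H−4} du dv. More precisely, for every ε > 0 there exists N such that for all d, d' ≥ N the left-hand side differs from the double integral by less than ε. -/
open MeasureTheory Set Filter Topology

theorem ae_fst_ne_snd : ∀ᵐ z : ℝ × ℝ, z.1 ≠ z.2 := by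
  have hm : MeasurableSet {z : ℝ × ℝ | z.1 = z.2} :=
    measurableSet_eq_fun measurable_fst measurable_snd
  have h0 : volume {z : ℝ × ℝ | z.1 = z.2} = 0 := by
    rw [Measure.volume_eq_prod, Measure.measure_prod_null hm]
    refine Eventually.of_forall fun x => ?_
    have : Prod.mk x ⁻¹' {z : ℝ × ℝ | z.1 = z.2} = {x} := by
      ext y
      simp [eq_comm]
    simp [this]
  simpa [ae_iff] using h0

theorem integrableOn_abs_sub_rpow {a : ℝ} (ha : -1 < a) :
    IntegrableOn (fun z : ℝ × ℝ => |z.1 - z.2| ^ a) (Ioc 0 1 ×ˢ Ioc 0 1) := by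
  have hg : IntegrableOn (fun x : ℝ => |x| ^ a) (Icc (-1) 1) := by
    have hpos : IntervalIntegrable (fun x : ℝ => |x| ^ a) volume 0 1 := by
      refine (intervalIntegral.intervalIntegrable_rpow' ha).congr fun x hx => ?_
      rw [uIoc_of_le zero_le_one] at hx
      simp only [abs_of_pos hx.1]
    have hneg : IntervalIntegrable (fun x : ℝ => |x| ^ a) volume (-1) 0 := by
      have := (hpos.comp_sub_left 0).symm
      simpa using this
    rw [integrableOn_Icc_iff_integrableOn_Ioc]
    exact (intervalIntegrable_iff_integrableOn_Ioc_of_le (by norm_num)).1 (hneg.trans hpos)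
  have hf : Integrable ((Icc (0 : ℝ) 1).indicator fun _ => (1 : ℝ)) :=
    (integrable_indicator_iff measurableSet_Icc).2 (by simp)
  have hc := hf.convolution_integrand (ContinuousLinearMap.mul ℝ ℝ)
    ((integrable_indicator_iff measurableSet_Icc).2 hg)
  refine (hc.integrableOn (s := Ioc 0 1 ×ˢ Ioc 0 1)).congr_fun ?_
    (measurableSet_Ioc.prod measurableSet_Ioc)
  rintro ⟨u, v⟩ ⟨hu, hv⟩
  simp only [mem_Ioc] at hu hv
  have h1 : v ∈ Icc (0 : ℝ) 1 := ⟨hv.1.le, hv.2⟩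
  have h2 : u - v ∈ Icc (-1 : ℝ) 1 := ⟨by linarith, by linarith⟩
  simp [indicator_of_mem h1, indicator_of_mem h2]

theorem intervalIntegral_intervalIntegral_eq_setIntegral_prod {f : ℝ × ℝ → ℝ} {a b c d : ℝ}
    (hab : a ≤ b) (hcd : c ≤ d) (hf : IntegrableOn f (Ioc a b ×ˢ Ioc c d)) :
    ∫ u in a..b, ∫ v in c..d, f (u, v) = ∫ z in Ioc a b ×ˢ Ioc c d, f z := by
  rw [Measure.volume_eq_prod] at hf ⊢
  rw [setIntegral_prod f hf, intervalIntegral.integral_of_le hab]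
  simp only [intervalIntegral.integral_of_le hcd]

/-- The half-open cell `(p / d, (p + 1) / d]` of the uniform subdivision. -/
abbrev unifCell (d p : ℕ) : Set ℝ := Ioc ((p : ℝ) / d) (((p : ℝ) + 1) / d)

theorem monotone_natCast_div (d : ℕ) : Monotone fun p : ℕ => (p : ℝ) / d :=
  fun _ _ h => by dsimp only; gcongr

theorem biUnion_unifCell {d : ℕ} (hd : 0 < d) :
    ⋃ p ∈ Finset.range d, unifCell d p = Ioc 0 1 := by
  have h := (monotone_natCast_div d).biUnion_Ico_Ioc_map_succ 0 d
  have hd' : (d : ℝ) ≠ 0 := by positivity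
  simpa [unifCell, hd'] using h

theorem pairwise_disjoint_unifCell (d : ℕ) : Pairwise (Function.onFun Disjoint (unifCell d)) := by
  simpa [unifCell] using (monotone_natCast_div d).pairwise_disjoint_on_Ioc_succ

theorem unifCell_subset {d p : ℕ} (hp : p ∈ Finset.range d) : unifCell d p ⊆ Ioc 0 1 := by
  rw [← biUnion_unifCell (d := d) (by grind)]
  exact subset_biUnion_of_mem (u := unifCell d) hp

theorem sum_setIntegral_unifCell_prod {f : ℝ × ℝ → ℝ} {d d' : ℕ} (hd : 0 < d) (hd' : 0 < d')
    (hf : IntegrableOn f (Ioc 0 1 ×ˢ Ioc 0 1)) :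
    ∑ p ∈ Finset.range d, ∑ q ∈ Finset.range d', ∫ z in unifCell d p ×ˢ unifCell d' q, f z
      = ∫ z in Ioc 0 1 ×ˢ Ioc 0 1, f z := by
  have hU : (Ioc 0 1 ×ˢ Ioc 0 1 : Set (ℝ × ℝ)) =
      ⋃ i ∈ Finset.range d ×ˢ Finset.range d', unifCell d i.1 ×ˢ unifCell d' i.2 := by
    refine (congrArg₂ (· ×ˢ ·) (biUnion_unifCell hd) (biUnion_unifCell hd')).symm.trans ?_
    ext z
    simp only [mem_prod, mem_iUnion, Finset.mem_product, Prod.exists, exists_prop]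
    grind
  rw [← Finset.sum_product', hU, integral_biUnion_finset]
  · exact fun _ _ => measurableSet_Ioc.prod measurableSet_Ioc
  · rintro ⟨p, q⟩ - ⟨p', q'⟩ - hne
    by_cases h : p = p'
    · exact (pairwise_disjoint_unifCell d' (by grind : q ≠ q')).set_prod_right _ _
    · exact (pairwise_disjoint_unifCell d h).set_prod_left _ _
  · intro i hi
    rw [Finset.mem_product] at hi
    exact hf.mono_set (prod_mono (unifCell_subset hi.1) (unifCell_subset hi.2))

theorem mul_sq_setAverage_le {α : Type*} [MeasurableSpace α] {μ : Measure α} {s : Set α}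
    {f : α → ℝ} {r : ℝ} (hs : μ.real s = r) (hr : 0 < r) (hfin : μ s ≠ ⊤)
    (hf : IntegrableOn f s μ) (hf2 : IntegrableOn (fun x => f x ^ 2) s μ) :
    r * (r⁻¹ * ∫ x in s, f x ∂μ) ^ 2 ≤ ∫ x in s, f x ^ 2 ∂μ := by
  set c := r⁻¹ * ∫ x in s, f x ∂μ with hc
  have hI : ∫ x in s, f x ∂μ = r * c := by rw [hc]; field_simp
  have h0 : 0 ≤ ∫ x in s, (f x - c) ^ 2 ∂μ := integral_nonneg fun _ => sq_nonneg _
  have hcst : IntegrableOn (fun _ => c ^ 2) s μ := integrableOn_const hfin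
  have hexp : ∫ x in s, (f x - c) ^ 2 ∂μ = ∫ x in s, f x ^ 2 ∂μ - 2 * c * (r * c) + r * c ^ 2 := by
    have : ∀ x, (f x - c) ^ 2 = f x ^ 2 - 2 * c * f x + c ^ 2 := fun x => by ring
    have hlin : IntegrableOn (fun x => f x ^ 2 - 2 * c * f x) s μ := hf2.sub (hf.const_mul _)
    simp only [this]
    rw [integral_add hlin hcst, integral_sub hf2 (hf.const_mul _),
      integral_const_mul, hI, setIntegral_const, hs, smul_eq_mul]
  nlinarith

theorem volume_real_Ioc_prod {a b c d : ℝ} (hab : a ≤ b) (hcd : c ≤ d) :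
    volume.real (Ioc a b ×ˢ Ioc c d) = (b - a) * (d - c) := by
  rw [Measure.volume_eq_prod, measureReal_prod_prod, Real.volume_real_Ioc_of_le hab,
    Real.volume_real_Ioc_of_le hcd]

theorem volume_Ioc_prod_ne_top (a b c d : ℝ) : volume (Ioc a b ×ˢ Ioc c d) ≠ ⊤ := by
  rw [Measure.volume_eq_prod, Measure.prod_prod]
  exact ENNReal.mul_ne_top measure_Ioc_lt_top.ne measure_Ioc_lt_top.ne

theorem setIntegral_shifted_rpow_le {a b c d r δ e : ℝ} (hab : a ≤ b) (hcd : c ≤ d)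
    (hr : (b - a) * (d - c) = r) (hr0 : 0 < r) (hδ0 : 0 < δ) (hδ : (b - a) + (d - c) ≤ δ)
    (he : e ≤ 0)
    (hf : IntegrableOn (fun z : ℝ × ℝ => |z.1 - z.2| ^ e) (Ioc a b ×ˢ Ioc c d)) :
    ∫ z in Ioc a b ×ˢ Ioc c d, ((|z.1 - z.2| + δ) ^ e) ^ 2
      ≤ r * (r⁻¹ * ∫ z in Ioc a b ×ˢ Ioc c d, |z.1 - z.2| ^ e) ^ 2 := by
  have hS : MeasurableSet (Ioc a b ×ˢ Ioc c d) := measurableSet_Ioc.prod measurableSet_Ioc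
  have hvol : volume.real (Ioc a b ×ˢ Ioc c d) = r := by rw [volume_real_Ioc_prod hab hcd, hr]
  have hfin := volume_Ioc_prod_ne_top a b c d
  set m := r⁻¹ * ∫ z in Ioc a b ×ˢ Ioc c d, |z.1 - z.2| ^ e with hm
  have key : ∀ z ∈ Ioc a b ×ˢ Ioc c d, (|z.1 - z.2| + δ) ^ e ≤ m := by
    intro z hz
    have h1 : ∫ _ in Ioc a b ×ˢ Ioc c d, (|z.1 - z.2| + δ) ^ e
        ≤ ∫ w in Ioc a b ×ˢ Ioc c d, |w.1 - w.2| ^ e := by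
      refine setIntegral_mono_on_ae (integrableOn_const hfin) hf hS ?_
      filter_upwards [ae_fst_ne_snd] with w hw hwS
      refine Real.rpow_le_rpow_of_nonpos (abs_pos.2 (sub_ne_zero.2 hw)) ?_ he
      simp only [mem_prod, mem_Ioc] at hz hwS
      rw [abs_le]
      constructor <;> linarith [le_abs_self (z.1 - z.2), neg_abs_le (z.1 - z.2)]
    rw [setIntegral_const, hvol, smul_eq_mul] at h1
    rw [hm, ← div_eq_inv_mul, le_div_iff₀ hr0, mul_comm]
    exact h1
  calc ∫ z in Ioc a b ×ˢ Ioc c d, ((|z.1 - z.2| + δ) ^ e) ^ 2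
      ≤ ∫ _ in Ioc a b ×ˢ Ioc c d, m ^ 2 := by
        refine integral_mono_of_nonneg (Eventually.of_forall fun _ => sq_nonneg _)
          (integrableOn_const hfin) ?_
        filter_upwards [ae_restrict_mem hS] with z hz
        have := key z hz
        gcongr
    _ = r * m ^ 2 := by rw [setIntegral_const, hvol, smul_eq_mul]

theorem tendsto_setIntegral_shifted_rpow {S : Set (ℝ × ℝ)} {e : ℝ} (he : e ≤ 0)
    (hf : IntegrableOn (fun z : ℝ × ℝ => |z.1 - z.2| ^ e) S) {δ : ℕ → ℝ} (hδ : ∀ n, 0 ≤ δ n)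
    (hδ0 : Tendsto δ atTop (𝓝 0)) :
    Tendsto (fun n => ∫ z in S, (|z.1 - z.2| + δ n) ^ e) atTop
      (𝓝 (∫ z in S, |z.1 - z.2| ^ e)) := by
  have hne : ∀ᵐ z : ℝ × ℝ ∂volume.restrict S, 0 < |z.1 - z.2| := by
    filter_upwards [ae_restrict_of_ae ae_fst_ne_snd] with z hz
    exact abs_pos.2 (sub_ne_zero.2 hz)
  refine tendsto_integral_of_dominated_convergence (fun z => |z.1 - z.2| ^ e) (fun n => ?_) hf
    (fun n => ?_) ?_
  · exact Measurable.aestronglyMeasurable (by fun_prop)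
  · filter_upwards [hne] with z hz
    rw [Real.norm_of_nonneg (Real.rpow_nonneg (add_nonneg hz.le (hδ n)) _)]
    exact Real.rpow_le_rpow_of_nonpos hz (le_add_of_nonneg_right (hδ n)) he
  · filter_upwards [hne] with z hz
    have h : Tendsto (fun n => |z.1 - z.2| + δ n) atTop (𝓝 |z.1 - z.2|) := by
      simpa using hδ0.const_add |z.1 - z.2|
    exact h.rpow_const (Or.inl (ne_of_gt hz))


/-- **Equation (3.2)**: the Riemann-sum convergence, for `H ∈ (3/4, 1)`,
`(1/(dd')) ∑_{p<d} ∑_{q<d'} (dd' ∫∫ |u−v|^{2H−2})² → ∫_{[0,1]²} |u−v|^{4H−4} du dv`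
as `d, d' → ∞`. -/
theorem riemann_sum_convergence_rosenblatt
    (H : ℝ) (hH0 : 3 / 4 < H) (hH1 : H < 1) :
    ∀ ε > (0 : ℝ), ∃ N : ℕ, ∀ d d' : ℕ, N ≤ d → N ≤ d' →
      |(1 / ((d : ℝ) * (d' : ℝ)))
          * ∑ p ∈ Finset.range d, ∑ q ∈ Finset.range d',
              ((d : ℝ) * (d' : ℝ)
                * ∫ u in ((p : ℝ) / d)..(((p : ℝ) + 1) / d),
                    ∫ v in ((q : ℝ) / d')..(((q : ℝ) + 1) / d'),
                      |u - v| ^ (2 * H - 2)) ^ 2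
        - ∫ u in (0 : ℝ)..1, ∫ v in (0 : ℝ)..1, |u - v| ^ (4 * H - 4)| < ε := by
  intro ε hε
  have hsq : ∀ x : ℝ, 0 ≤ x → (x ^ (2 * H - 2)) ^ 2 = x ^ (4 * H - 4) := fun x hx => by
    rw [← Real.rpow_mul_natCast hx]
    congr 1
    push_cast
    ring
  have hK := integrableOn_abs_sub_rpow (a := 2 * H - 2) (by linarith)
  have hK2 := integrableOn_abs_sub_rpow (a := 4 * H - 4) (by linarith)
  have hδ0 : Tendsto (fun n : ℕ => 2 * (1 / ((n : ℝ) + 1))) atTop (𝓝 0) := by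
    simpa using tendsto_one_div_add_atTop_nhds_zero_nat.const_mul (2 : ℝ)
  have hlim := tendsto_setIntegral_shifted_rpow (by linarith) hK2 (fun n => by positivity) hδ0
  obtain ⟨n, hn⟩ := (hlim.eventually_const_lt (sub_lt_self _ hε)).exists
  refine ⟨n + 1, fun d d' hd hd' => ?_⟩
  have hd0 : 0 < d := by omega
  have hd0' : 0 < d' := by omega
  have hdR : (0 : ℝ) < d := by positivity
  have hdR' : (0 : ℝ) < d' := by positivity
  set δ : ℝ := 2 * (1 / ((n : ℝ) + 1)) with hδ
  have hδpos : 0 < δ := by positivity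
  rw [intervalIntegral_intervalIntegral_eq_setIntegral_prod
    (f := fun z : ℝ × ℝ => |z.1 - z.2| ^ (4 * H - 4)) zero_le_one zero_le_one hK2]
  set r : ℝ := 1 / ((d : ℝ) * d') with hr
  have hr0 : 0 < r := by positivity
  have hrinv : (d : ℝ) * d' = r⁻¹ := by rw [hr, one_div, inv_inv]
  have hle : ∀ k p : ℕ, (p : ℝ) / k ≤ ((p : ℝ) + 1) / k := fun k p => by gcongr; linarith
  have hlen : ∀ k p : ℕ, ((p : ℝ) + 1) / k - (p : ℝ) / k = 1 / k := fun k p => by ring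
  have hterm : ∀ p ∈ Finset.range d, ∀ q ∈ Finset.range d',
      (∫ z in unifCell d p ×ˢ unifCell d' q, (|z.1 - z.2| + δ) ^ (4 * H - 4)
        ≤ r * ((d : ℝ) * (d' : ℝ)
                * ∫ u in ((p : ℝ) / d)..(((p : ℝ) + 1) / d),
                    ∫ v in ((q : ℝ) / d')..(((q : ℝ) + 1) / d'),
                      |u - v| ^ (2 * H - 2)) ^ 2) ∧
      r * ((d : ℝ) * (d' : ℝ)
                * ∫ u in ((p : ℝ) / d)..(((p : ℝ) + 1) / d),
                    ∫ v in ((q : ℝ) / d')..(((q : ℝ) + 1) / d'),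
                      |u - v| ^ (2 * H - 2)) ^ 2
        ≤ ∫ z in unifCell d p ×ˢ unifCell d' q, |z.1 - z.2| ^ (4 * H - 4) := by
    intro p hp q hq
    have hsub := prod_mono (unifCell_subset hp) (unifCell_subset hq)
    have hKB := hK.mono_set hsub
    have hK2B := hK2.mono_set hsub
    have hvol : (((p : ℝ) + 1) / d - (p : ℝ) / d) * (((q : ℝ) + 1) / d' - (q : ℝ) / d') = r := by
      rw [hlen, hlen, hr]
      field_simp
    rw [intervalIntegral_intervalIntegral_eq_setIntegral_prod
      (f := fun z : ℝ × ℝ => |z.1 - z.2| ^ (2 * H - 2)) (hle d p) (hle d' q) hKB, hrinv]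
    constructor
    · have hδle : (((p : ℝ) + 1) / d - (p : ℝ) / d) + (((q : ℝ) + 1) / d' - (q : ℝ) / d') ≤ δ := by
        have h1 : 1 / (d : ℝ) ≤ 1 / ((n : ℝ) + 1) := by gcongr; exact_mod_cast hd
        have h2 : 1 / (d' : ℝ) ≤ 1 / ((n : ℝ) + 1) := by gcongr; exact_mod_cast hd'
        rw [hlen, hlen]
        linarith
      have h := setIntegral_shifted_rpow_le (hle d p) (hle d' q) hvol hr0 hδpos hδle
        (by linarith) hKB
      simpa only [hsq _ (add_nonneg (abs_nonneg _) hδpos.le)] using h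
    · have h := mul_sq_setAverage_le ((volume_real_Ioc_prod (hle d p) (hle d' q)).trans hvol) hr0
        (volume_Ioc_prod_ne_top _ _ _ _) hKB (by simpa only [hsq _ (abs_nonneg _)] using hK2B)
      simpa only [hsq _ (abs_nonneg _)] using h
  have hKδ : IntegrableOn (fun z : ℝ × ℝ => (|z.1 - z.2| + δ) ^ (4 * H - 4))
      (Ioc 0 1 ×ˢ Ioc 0 1) := by
    refine hK2.mono' (Measurable.aestronglyMeasurable (by fun_prop)) ?_
    filter_upwards [ae_restrict_of_ae ae_fst_ne_snd] with z hz
    rw [Real.norm_of_nonneg (by positivity)]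
    exact Real.rpow_le_rpow_of_nonpos (abs_pos.2 (sub_ne_zero.2 hz))
      (le_add_of_nonneg_right hδpos.le) (by linarith)
  have hlow := Finset.sum_le_sum fun p hp => Finset.sum_le_sum fun q hq => (hterm p hp q hq).1
  have hupp := Finset.sum_le_sum fun p hp => Finset.sum_le_sum fun q hq => (hterm p hp q hq).2
  rw [sum_setIntegral_unifCell_prod hd0 hd0' hKδ] at hlow
  rw [sum_setIntegral_unifCell_prod hd0 hd0' hK2] at hupp
  simp only [← Finset.mul_sum] at hlow hupp
  rw [abs_lt]
  constructor <;> linarith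
end

section
/- Let m ≥ 1, let γ be the standard Gaussian measure on ℝ^m, let h : ℝ^m → ℝ be 1-Lipschitz, and let ε > 0. Define h_ε(x) = ∫_{ℝ^m} h(x + εy) γ(dy). Then h_ε is twice differentiable and for all x ∈ ℝ^m and all 1 ≤ i, j ≤ m, |∂²h_ε/∂x_i∂x_j (x)| ≤ 1/ε. -/
open MeasureTheory ProbabilityTheory

/-- The standard Gaussian measure on `ι → ℝ`, as a product measure. -/
noncomputable abbrev gaussianPi (ι : Type*) [Fintype ι] : Measure (ι → ℝ) :=
  Measure.pi fun _ : ι => gaussianReal 0 1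

/-- A product of measures with integrable real densities has the product density. -/
lemma pi_withDensity_ofReal {ι : Type*} [Fintype ι] {μ : ι → Measure ℝ} [∀ i, SigmaFinite (μ i)]
    {f : ι → ℝ → ℝ} (hf : ∀ i, Integrable (f i) (μ i)) (hf0 : ∀ i x, 0 ≤ f i x) :
    Measure.pi (fun i => (μ i).withDensity fun x => ENNReal.ofReal (f i x)) =
      (Measure.pi μ).withDensity fun x => ENNReal.ofReal (∏ i, f i (x i)) := by
  have : ∀ i, IsFiniteMeasure ((μ i).withDensity fun x => ENNReal.ofReal (f i x)) := fun i =>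
    isFiniteMeasure_withDensity_ofReal (hf i).2
  refine Measure.pi_eq fun s hs => ?_
  rw [withDensity_apply _ (.univ_pi hs), Measure.restrict_pi_pi,
    ← ofReal_integral_eq_lintegral_ofReal
      (Integrable.fintype_prod fun i => (hf i).restrict)
      (ae_of_all _ fun x => Finset.prod_nonneg fun i _ => hf0 i _),
    integral_fintype_prod_eq_prod,
    ENNReal.ofReal_prod_of_nonneg fun i _ => integral_nonneg (hf0 i)]
  refine Finset.prod_congr rfl fun i _ => ?_
  rw [withDensity_apply _ (hs i), ofReal_integral_eq_lintegral_ofReal (hf i).restrict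
    (ae_of_all _ (hf0 i))]

lemma gaussianPi_absolutelyContinuous (ι : Type*) [Fintype ι] :
    gaussianPi ι ≪ (volume : Measure (ι → ℝ)) := by
  have h : gaussianPi ι = (volume : Measure (ι → ℝ)).withDensity
      fun x => ENNReal.ofReal (∏ i, gaussianPDFReal 0 1 (x i)) := by
    rw [volume_pi, ← pi_withDensity_ofReal (fun _ => integrable_gaussianPDFReal 0 1)
      (fun _ => gaussianPDFReal_nonneg 0 1)]
    simp only [gaussianPi, gaussianReal_of_var_ne_zero 0 one_ne_zero, gaussianPDF_def]
  rw [h]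
  exact withDensity_absolutelyContinuous _ _

lemma integrable_exp_mul_sub_gaussianReal (t : ℝ) :
    Integrable (fun y => Real.exp (t * y - t ^ 2 / 2)) (gaussianReal 0 1) := by
  simp only [Real.exp_sub]
  exact (integrable_exp_mul_gaussianReal t).div_const _

lemma gaussianReal_eq_withDensity_exp (t : ℝ) :
    gaussianReal t 1 =
      (gaussianReal 0 1).withDensity fun y => ENNReal.ofReal (Real.exp (t * y - t ^ 2 / 2)) := by
  rw [gaussianReal_of_var_ne_zero _ one_ne_zero, gaussianReal_of_var_ne_zero _ one_ne_zero,
    ← withDensity_mul _ (measurable_gaussianPDF _ _) (by fun_prop)]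
  congr 1
  ext y
  rw [Pi.mul_apply, gaussianPDF, gaussianPDF, ← ENNReal.ofReal_mul (gaussianPDFReal_nonneg _ _ _),
    gaussianPDFReal_def, gaussianPDFReal_def]
  beta_reduce
  rw [mul_assoc _ _ (Real.exp (t * y - t ^ 2 / 2)), ← Real.exp_add]
  congr 3
  simp only [NNReal.coe_one]
  ring

/-- The Cameron-Martin formula in finite dimension. -/
lemma integral_add_gaussianPi {ι : Type*} [Fintype ι] (g : (ι → ℝ) → ℝ) (t : ι → ℝ) :
    ∫ y, g (t + y) ∂gaussianPi ι =
      ∫ y, Real.exp (∑ i, (t i * y i - t i ^ 2 / 2)) * g y ∂gaussianPi ι := by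
  have hmap : (gaussianPi ι).map (fun y => t + y) = (gaussianPi ι).withDensity
      fun y => ENNReal.ofReal (Real.exp (∑ i, (t i * y i - t i ^ 2 / 2))) := by
    have h1 : (gaussianPi ι).map (fun y => t + y) =
        Measure.pi fun i => (gaussianReal 0 1).map (fun z => t i + z) := by
      rw [← Measure.pi_map_pi (f := fun i z => t i + z) (fun i => by fun_prop)]
      rfl
    simp only [h1, gaussianReal_map_const_add, zero_add, gaussianReal_eq_withDensity_exp (t _),
      Real.exp_sum]
    exact pi_withDensity_ofReal (fun i => integrable_exp_mul_sub_gaussianReal (t i))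
      (fun _ _ => (Real.exp_pos _).le)
  rw [← (measurableEmbedding_addLeft t).integral_map, hmap,
    integral_withDensity_eq_integral_toReal_smul (by fun_prop)
      (ae_of_all _ fun _ => ENNReal.ofReal_lt_top)]
  simp only [ENNReal.toReal_ofReal (Real.exp_pos _).le, smul_eq_mul]

lemma integrable_exp_mul_sum_abs_gaussianPi (ι : Type*) [Fintype ι] (c : ℝ) :
    Integrable (fun y => Real.exp (c * ∑ i, |y i|)) (gaussianPi ι) := by
  simp only [Finset.mul_sum, Real.exp_sum]
  refine Integrable.fintype_prod (f := fun _ z => Real.exp (c * |z|)) fun _ => ?_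
  exact integrable_exp_mul_abs (X := id) (integrable_exp_mul_gaussianReal c)
    (integrable_exp_mul_gaussianReal (-c))

lemma integral_abs_apply_gaussianPi_le_one {ι : Type*} [Fintype ι] (i : ι) :
    Integrable (fun y => |y i|) (gaussianPi ι) ∧ ∫ y, |y i| ∂gaussianPi ι ≤ 1 := by
  have hp := measurePreserving_eval (fun _ : ι => gaussianReal 0 1) i
  have hsq : Integrable (fun z : ℝ => z ^ 2) (gaussianReal 0 1) :=
    (memLp_id_gaussianReal 2).integrable_sq
  have habs : Integrable (fun z : ℝ => |z|) (gaussianReal 0 1) :=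
    (memLp_one_iff_integrable.1 (memLp_id_gaussianReal 1)).abs
  have hval : ∫ z : ℝ, z ^ 2 ∂gaussianReal 0 1 = 1 := by
    rw [← variance_of_integral_eq_zero (X := fun z : ℝ => z) (by fun_prop)
      integral_id_gaussianReal, variance_fun_id_gaussianReal]
    rfl
  refine ⟨hp.integrable_comp_of_integrable habs, ?_⟩
  calc ∫ y, |y i| ∂gaussianPi ι = ∫ z : ℝ, |z| ∂gaussianReal 0 1 :=
        (integral_map (measurable_pi_apply i).aemeasurable
          (by rw [hp.map_eq]; exact habs.1)).symm.trans (by rw [hp.map_eq])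
    _ ≤ ∫ z : ℝ, (1 + z ^ 2) / 2 ∂gaussianReal 0 1 := by
        refine integral_mono habs (((integrable_const 1).add hsq).div_const 2) fun z => ?_
        nlinarith [sq_nonneg (|z| - 1), sq_abs z]
    _ = 1 := by
        rw [integral_div, integral_add (integrable_const 1) hsq, hval]
        simp

/-- The continuous linear form `v ↦ ∑ i, y i * v i` on `ι → ℝ`. -/
noncomputable def dotCLM {ι : Type*} [Fintype ι] (y : ι → ℝ) : (ι → ℝ) →L[ℝ] ℝ :=
  ∑ i, y i • ContinuousLinearMap.proj i

lemma dotCLM_apply {ι : Type*} [Fintype ι] (y v : ι → ℝ) : dotCLM y v = ∑ i, y i * v i := by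
  simp [dotCLM]

lemma continuous_dotCLM {ι : Type*} [Fintype ι] :
    Continuous (dotCLM : (ι → ℝ) → (ι → ℝ) →L[ℝ] ℝ) := by
  unfold dotCLM
  fun_prop

lemma abs_dotCLM_le {ι : Type*} [Fintype ι] (y v : ι → ℝ) :
    |dotCLM y v| ≤ (∑ i, |y i|) * ‖v‖ := by
  rw [dotCLM_apply, Finset.sum_mul]
  refine (Finset.abs_sum_le_sum_abs _ _).trans (Finset.sum_le_sum fun i _ => ?_)
  rw [abs_mul]
  exact mul_le_mul_of_nonneg_left (norm_le_pi_norm v i) (abs_nonneg _)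

lemma norm_dotCLM_le {ι : Type*} [Fintype ι] (y : ι → ℝ) : ‖dotCLM y‖ ≤ ∑ i, |y i| :=
  (dotCLM y).opNorm_le_bound (by positivity) (abs_dotCLM_le y)

lemma norm_exp_dotCLM_smul_le {ι : Type*} [Fintype ι] {c C R : ℝ} (hc : |c| ≤ C)
    (y : ι → ℝ) {t : ι → ℝ} (ht : ‖t‖ ≤ R) :
    ‖(Real.exp (dotCLM y t) * c) • dotCLM y‖ ≤ C * Real.exp ((R + 1) * ∑ i, |y i|) := by
  have hC : 0 ≤ C := (abs_nonneg c).trans hc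
  set s := ∑ i, |y i| with hs
  have hs0 : 0 ≤ s := by positivity
  have hexp : Real.exp (dotCLM y t) ≤ Real.exp (R * s) :=
    Real.exp_le_exp.2 (((le_abs_self _).trans (abs_dotCLM_le y t)).trans
      (by rw [mul_comm]; exact mul_le_mul_of_nonneg_right ht hs0))
  have hle : s ≤ Real.exp s := by linarith [Real.add_one_le_exp s]
  calc ‖(Real.exp (dotCLM y t) * c) • dotCLM y‖
      = Real.exp (dotCLM y t) * |c| * ‖dotCLM y‖ := by
        rw [norm_smul, norm_mul, Real.norm_eq_abs, Real.norm_eq_abs, Real.abs_exp]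
    _ ≤ Real.exp (R * s) * C * Real.exp s := by
        gcongr
        exact (norm_dotCLM_le y).trans hle
    _ = C * Real.exp ((R + 1) * s) := by rw [add_mul, one_mul, Real.exp_add]; ring

/-- The moment generating function of a bounded density with respect to the Gaussian measure is
differentiable. -/
lemma hasFDerivAt_integral_exp_dotCLM_mul {ι : Type*} [Fintype ι] {f : (ι → ℝ) → ℝ}
    (hf : Measurable f) {C : ℝ} (hC : ∀ y, |f y| ≤ C) (t : ι → ℝ) :
    HasFDerivAt (fun t => ∫ y, Real.exp (dotCLM y t) * f y ∂gaussianPi ι)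
      (∫ y, (Real.exp (dotCLM y t) * f y) • dotCLM y ∂gaussianPi ι) t := by
  have hmeas : ∀ t, Measurable fun y => Real.exp (dotCLM y t) * f y := fun t =>
    (Real.measurable_exp.comp (continuous_dotCLM.clm_apply continuous_const).measurable).mul hf
  refine hasFDerivAt_integral_of_dominated_of_fderiv_le (Metric.ball_mem_nhds t one_pos)
    (F' := fun t y => (Real.exp (dotCLM y t) * f y) • dotCLM y)
    (bound := fun y => C * Real.exp ((‖t‖ + 1 + 1) * ∑ i, |y i|))
    (.of_forall fun t => (hmeas t).aestronglyMeasurable) ?_ ?_ ?_ ?_ ?_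
  · refine ((integrable_exp_mul_sum_abs_gaussianPi ι ‖t‖).const_mul C).mono'
      (hmeas t).aestronglyMeasurable (ae_of_all _ fun y => ?_)
    rw [norm_mul, Real.norm_eq_abs, Real.norm_eq_abs, Real.abs_exp, mul_comm, mul_comm ‖t‖]
    exact mul_le_mul (hC y)
      (Real.exp_le_exp.2 ((le_abs_self _).trans (abs_dotCLM_le y t))) (Real.exp_pos _).le
      ((abs_nonneg _).trans (hC y))
  · exact ((hmeas t).smul continuous_dotCLM.measurable).aestronglyMeasurable
  · refine ae_of_all _ fun y u hu => norm_exp_dotCLM_smul_le (hC y) y ?_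
    linarith [norm_le_norm_add_norm_sub' u t, mem_ball_iff_norm.1 hu]
  · exact (integrable_exp_mul_sum_abs_gaussianPi ι _).const_mul C
  · refine ae_of_all _ fun y u _ => ?_
    refine (((dotCLM y).hasFDerivAt (x := u)).exp.mul_const (f y)).congr_fderiv ?_
    rw [smul_smul, mul_comm]

lemma contDiff_integral_exp_dotCLM_mul {ι : Type*} [Fintype ι] {f : (ι → ℝ) → ℝ}
    (hf : Measurable f) {C : ℝ} (hC : ∀ y, |f y| ≤ C) :
    ContDiff ℝ 1 (fun t => ∫ y, Real.exp (dotCLM y t) * f y ∂gaussianPi ι) := by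
  have hderiv := hasFDerivAt_integral_exp_dotCLM_mul hf hC
  refine contDiff_one_iff_fderiv.2 ⟨fun t => (hderiv t).differentiableAt, ?_⟩
  rw [funext fun t => (hderiv t).fderiv]
  refine continuous_iff_continuousAt.2 fun t => continuousAt_of_dominated
    (bound := fun y => C * Real.exp ((‖t‖ + 1 + 1) * ∑ i, |y i|))
    (.of_forall fun u => ?_) ?_ ((integrable_exp_mul_sum_abs_gaussianPi ι _).const_mul C)
    (ae_of_all _ fun y => ?_)
  · exact (((Real.measurable_exp.comp
      (continuous_dotCLM.clm_apply continuous_const).measurable).mul hf).smul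
        continuous_dotCLM.measurable).aestronglyMeasurable
  · filter_upwards [Metric.ball_mem_nhds t one_pos] with u hu
    refine ae_of_all _ fun y => norm_exp_dotCLM_smul_le (hC y) y ?_
    linarith [norm_le_norm_add_norm_sub' u t, mem_ball_iff_norm.1 hu]
  · fun_prop

/-- The Gaussian smoothing `x ↦ ∫ g (x + ε y) γ(dy)` at scale `ε`. -/
noncomputable def gaussianSmoothing {ι : Type*} [Fintype ι] (ε : ℝ) (g : (ι → ℝ) → ℝ)
    (x : ι → ℝ) : ℝ :=
  ∫ y, g (x + ε • y) ∂gaussianPi ι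

lemma gaussianSmoothing_eq {ι : Type*} [Fintype ι] {ε : ℝ} (hε : ε ≠ 0) (g : (ι → ℝ) → ℝ)
    (x z : ι → ℝ) :
    gaussianSmoothing ε g z = Real.exp (-∑ i, (ε⁻¹ • (z - x)) i ^ 2 / 2) *
      ∫ y, Real.exp (dotCLM y (ε⁻¹ • (z - x))) * g (x + ε • y) ∂gaussianPi ι := by
  have h := integral_add_gaussianPi (fun y => g (x + ε • y)) (ε⁻¹ • (z - x))
  simp only [smul_add, smul_inv_smul₀ hε, ← add_assoc, add_sub_cancel] at h
  rw [gaussianSmoothing, h, ← integral_const_mul]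
  refine integral_congr_ae (ae_of_all _ fun y => ?_)
  simp only [dotCLM_apply, ← mul_assoc, ← Real.exp_add, Finset.sum_sub_distrib]
  congr 2
  rw [sub_eq_neg_add]
  simp only [mul_comm]

lemma contDiff_gaussianSmoothing {ι : Type*} [Fintype ι] {ε : ℝ} (hε : ε ≠ 0) {g : (ι → ℝ) → ℝ}
    (hg : Measurable g) {C : ℝ} (hC : ∀ y, |g y| ≤ C) :
    ContDiff ℝ 1 (gaussianSmoothing ε g) := by
  rw [funext (gaussianSmoothing_eq hε g 0)]
  have hM := contDiff_integral_exp_dotCLM_mul (f := fun y => g (0 + ε • y))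
    (hg.comp (by fun_prop)) (fun y => hC _)
  have hlin : ContDiff ℝ 1 fun z : ι → ℝ => ε⁻¹ • (z - 0) := by fun_prop
  have hsq : ContDiff ℝ 1 fun t : ι → ℝ => Real.exp (-∑ i, t i ^ 2 / 2) := by fun_prop
  exact (hsq.comp hlin).mul (hM.comp hlin)

/-- Gaussian integration by parts for the smoothing of a bounded function. -/
lemma fderiv_gaussianSmoothing_single {ι : Type*} [Fintype ι] [DecidableEq ι] {ε : ℝ}
    (hε : ε ≠ 0) {g : (ι → ℝ) → ℝ} (hg : Measurable g) {C : ℝ} (hC : ∀ y, |g y| ≤ C)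
    (x : ι → ℝ) (i : ι) :
    fderiv ℝ (gaussianSmoothing ε g) x (Pi.single i 1) =
      ε⁻¹ * ∫ y, y i * g (x + ε • y) ∂gaussianPi ι := by
  have hf : Measurable fun y : ι → ℝ => g (x + ε • y) := hg.comp (by fun_prop)
  have hM := hasFDerivAt_integral_exp_dotCLM_mul hf (fun y => hC _) (ε⁻¹ • (x - x))
  have hlin : HasFDerivAt (fun z : ι → ℝ => ε⁻¹ • (z - x))
      (ε⁻¹ • ContinuousLinearMap.id ℝ (ι → ℝ)) x := by
    simpa using ((hasFDerivAt_id (𝕜 := ℝ) x).sub_const x).const_smul ε⁻¹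
  have hsq : HasFDerivAt (fun t : ι → ℝ => Real.exp (-∑ i, t i ^ 2 / 2))
      (0 : (ι → ℝ) →L[ℝ] ℝ) (ε⁻¹ • (x - x)) := by
    have h2 : HasFDerivAt (fun t : ι → ℝ => ∑ i, t i ^ 2 / 2)
        (0 : (ι → ℝ) →L[ℝ] ℝ) (ε⁻¹ • (x - x)) := by
      have h3 := HasFDerivAt.fun_sum (u := Finset.univ) fun i (_ : i ∈ Finset.univ) =>
        (((ContinuousLinearMap.proj (R := ℝ) (φ := fun _ : ι => ℝ) i).hasFDerivAt
          (x := ε⁻¹ • (x - x))).pow 2).mul_const (2⁻¹ : ℝ)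
      simpa [div_eq_mul_inv] using h3
    simpa using h2.neg.exp
  have hint : Integrable (fun y => g (x + ε • y) • dotCLM y) (gaussianPi ι) := by
    refine ((integrable_finsetSum Finset.univ fun i _ =>
      (integral_abs_apply_gaussianPi_le_one i).1).const_mul C).mono'
      (hf.smul continuous_dotCLM.measurable).aestronglyMeasurable (ae_of_all _ fun y => ?_)
    rw [norm_smul]
    exact mul_le_mul (hC _) (norm_dotCLM_le y) (norm_nonneg _) ((abs_nonneg _).trans (hC 0))
  have hG := (hsq.mul hM).comp x hlin
  have hG' : HasFDerivAt (gaussianSmoothing ε g) _ x :=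
    hG.congr_of_eventuallyEq (.of_forall fun z => gaussianSmoothing_eq hε g x z)
  rw [hG'.fderiv]
  simp [ContinuousLinearMap.integral_apply hint, dotCLM_apply, Pi.single_apply, mul_comm]

lemma abs_fderiv_gaussianSmoothing_single_le {ι : Type*} [Fintype ι] [DecidableEq ι] {ε : ℝ}
    (hε : 0 < ε) {g : (ι → ℝ) → ℝ} (hg : Measurable g) {C : ℝ} (hC : ∀ y, |g y| ≤ C)
    (x : ι → ℝ) (i : ι) :
    |fderiv ℝ (gaussianSmoothing ε g) x (Pi.single i 1)| ≤ C / ε := by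
  have hC0 : 0 ≤ C := (abs_nonneg _).trans (hC 0)
  obtain ⟨hi, hle⟩ := integral_abs_apply_gaussianPi_le_one i
  rw [fderiv_gaussianSmoothing_single hε.ne' hg hC, abs_mul, abs_of_pos (inv_pos.2 hε),
    div_eq_inv_mul]
  refine mul_le_mul_of_nonneg_left ?_ (inv_pos.2 hε).le
  calc |∫ y, y i * g (x + ε • y) ∂gaussianPi ι|
      ≤ ∫ y, |y i| * C ∂gaussianPi ι := by
        rw [← Real.norm_eq_abs]
        refine norm_integral_le_of_norm_le (hi.mul_const C) (ae_of_all _ fun y => ?_)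
        rw [norm_mul]
        exact mul_le_mul_of_nonneg_left (hC _) (abs_nonneg _)
    _ ≤ C := by
        rw [integral_mul_const]
        exact mul_le_of_le_one_left hC0 hle

/-- A Lipschitz function can be differentiated under the Gaussian smoothing. -/
lemma hasFDerivAt_gaussianSmoothing_of_lipschitz {ι : Type*} [Fintype ι] {ε : ℝ} (hε : ε ≠ 0)
    {h : (ι → ℝ) → ℝ} {K : NNReal} (hh : LipschitzWith K h) (x : ι → ℝ) :
    Integrable (fun y => fderiv ℝ h (x + ε • y)) (gaussianPi ι) ∧
    HasFDerivAt (gaussianSmoothing ε h) (∫ y, fderiv ℝ h (x + ε • y) ∂gaussianPi ι) x := by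
  have hcont := hh.continuous
  have hdiff : ∀ᵐ y ∂gaussianPi ι, DifferentiableAt ℝ h (x + ε • y) := by
    refine (gaussianPi_absolutelyContinuous ι).ae_le ?_
    have hlip : LipschitzWith (K * ‖ε‖₊) fun y : ι → ℝ => h (x + ε • y) :=
      hh.comp (by simpa using (LipschitzWith.const x).add (lipschitzWith_smul ε))
    filter_upwards [hlip.ae_differentiableAt] with y hy
    have hinv : DifferentiableAt ℝ (fun z => ε⁻¹ • (z - x)) (x + ε • y) := by fun_prop
    have hcomp := DifferentiableAt.comp (x + ε • y) (g := fun y => h (x + ε • y))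
      (by simpa [inv_smul_smul₀ hε] using hy) hinv
    simpa [Function.comp_def, smul_inv_smul₀ hε] using hcomp
  refine hasFDerivAt_integral_of_dominated_loc_of_lip (bound := fun _ => (K : ℝ))
    Filter.univ_mem (.of_forall fun z => ?_) ?_ ?_ (ae_of_all _ fun y => ?_)
    (integrable_const _) ?_
  · exact (by fun_prop : Continuous fun y : ι → ℝ => h (z + ε • y)).aestronglyMeasurable
  · refine ((integrable_const |h x|).add (((integrable_finsetSum Finset.univ fun i _ =>
      (integral_abs_apply_gaussianPi_le_one (ι := ι) i).1).const_mul (K * |ε|)))).mono'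
      (by fun_prop : Continuous fun y : ι → ℝ => h (x + ε • y)).aestronglyMeasurable
      (ae_of_all _ fun y => ?_)
    have h1 := hh.norm_sub_le (x + ε • y) x
    rw [add_sub_cancel_left, norm_smul, Real.norm_eq_abs ε] at h1
    have h2 : ‖y‖ ≤ ∑ i, |y i| := (pi_norm_le_iff_of_nonneg (by positivity)).2 fun i =>
      Finset.single_le_sum (f := fun i => |y i|) (fun _ _ => abs_nonneg _) (Finset.mem_univ i)
    have h3 : K * (|ε| * ‖y‖) ≤ K * |ε| * ∑ i, |y i| := by rw [← mul_assoc]; gcongr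
    have h4 := norm_le_norm_add_norm_sub' (h (x + ε • y)) (h x)
    simp only [Pi.add_apply]
    rw [Real.norm_eq_abs (h x)] at h4
    linarith
  · exact ((measurable_fderiv ℝ h).comp (by fun_prop)).aestronglyMeasurable
  · have hlip : LipschitzWith K fun z => h (z + ε • y) := by
      simpa [Function.comp_def] using hh.comp (LipschitzWith.id.add (LipschitzWith.const (ε • y)))
    simpa using hlip.lipschitzOnWith (s := Set.univ)
  · filter_upwards [hdiff] with y hy
    exact (hasFDerivAt_comp_add_right (ε • y)).2 hy.hasFDerivAt


/-- **Key step in the proof of Proposition 4.4**: Gaussian smoothing of a `1`-Lipschitz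
function. If `γ` is the standard Gaussian measure on `ℝ^m` and
`h_ε(x) = ∫ h(x + εy) γ(dy)`, then `h_ε` is twice (continuously) differentiable and all its
second partial derivatives are bounded by `1/ε`. -/
theorem gaussian_smoothing_second_derivative_bound
    (m : ℕ) (hm : 1 ≤ m)
    (h : (Fin m → ℝ) → ℝ)
    (hh : ∀ a b : Fin m → ℝ, |h a - h b| ≤ Real.sqrt (∑ i : Fin m, (a i - b i) ^ 2))
    (ε : ℝ) (hε : 0 < ε)
    (γ : Measure (Fin m → ℝ))
    (hγ : γ = Measure.pi (fun _ : Fin m => gaussianReal 0 1))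
    (hε_fun : (Fin m → ℝ) → ℝ)
    (hε_def : ∀ x, hε_fun x = ∫ y, h (x + ε • y) ∂γ) :
    ContDiff ℝ 2 hε_fun
    ∧ ∀ (x : Fin m → ℝ) (i j : Fin m),
        |fderiv ℝ (fun y => fderiv ℝ hε_fun y (Pi.single j 1)) x (Pi.single i 1)| ≤ 1 / ε := by
  subst hγ
  have hsmooth : hε_fun = gaussianSmoothing ε h := funext hε_def
  have hlip : LipschitzWith (NNReal.sqrt m) h := by
    refine LipschitzWith.of_dist_le_mul fun a b => (hh a b).trans ?_
    rw [Real.coe_sqrt, NNReal.coe_natCast]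
    refine Real.sqrt_le_iff.2 ⟨by positivity, ?_⟩
    rw [mul_pow, Real.sq_sqrt (Nat.cast_nonneg m)]
    calc ∑ i, (a i - b i) ^ 2 ≤ ∑ _i : Fin m, dist a b ^ 2 :=
          Finset.sum_le_sum fun i _ => sq_le_sq' (by
            linarith [neg_abs_le (a i - b i), dist_le_pi_dist a b i, Real.dist_eq (a i) (b i)])
            ((le_abs_self _).trans (dist_le_pi_dist a b i))
      _ = m * dist a b ^ 2 := by simp
  have hbound : ∀ (j : Fin m) (x : Fin m → ℝ), |fderiv ℝ h x (Pi.single j 1)| ≤ 1 := by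
    intro j x
    by_cases hd : DifferentiableAt ℝ h x
    · refine HasDerivAt.le_of_lip' (hd.hasFDerivAt.hasLineDerivAt (Pi.single j 1)) zero_le_one
        (.of_forall fun t => (hh _ _).trans_eq ?_)
      simp [Pi.single_apply, Real.sqrt_sq_eq_abs]
    · simp [fderiv_zero_of_not_differentiableAt hd]
  have hderiv := hasFDerivAt_gaussianSmoothing_of_lipschitz hε.ne' hlip
  have hpartial : ∀ v : Fin m → ℝ, (fun x => fderiv ℝ (gaussianSmoothing ε h) x v) =
      gaussianSmoothing ε fun x => fderiv ℝ h x v := fun v => funext fun x => by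
    rw [(hderiv x).2.fderiv, ContinuousLinearMap.integral_apply (hderiv x).1]
    rfl
  rw [hsmooth]
  refine ⟨?_, fun x i j => ?_⟩
  · rw [show (2 : WithTop ℕ∞) = 1 + 1 from one_add_one_eq_two.symm,
      contDiff_succ_iff_fderiv_apply]
    refine ⟨fun x => (hderiv x).2.differentiableAt, by simp, fun v => ?_⟩
    rw [hpartial]
    exact contDiff_gaussianSmoothing hε.ne' (measurable_fderiv_apply_const ℝ h v)
      fun y => (fderiv ℝ h y).le_of_opNorm_le (norm_fderiv_le_of_lipschitz ℝ hlip) v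
  · rw [hpartial]
    exact abs_fderiv_gaussianSmoothing_single_le hε (measurable_fderiv_apply_const ℝ h _)
      (hbound j) x i
end
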